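/- arXiv:2206.01464 — 14 statements merged into one kernel-verified Lean document; each statement's English description precedes it below -/
import Mathlib

section
/- Let R be a pointwise semicommutative ring. Then R is directly finite, i.e., for all w, h ∈ R, w·h = 1 implies h·w = 1. -/
/-- A ring `R` is *pointwise semicommutative* if for every `a ∈ R`, either the left
annihilator `l(a)` or the right annihilator `r(a)` is a two-sided ideal of `R`;
equivalently, for every `a`, either (`∀ x r, x*a = 0 → x*r*a = 0`) or
(`∀ x r, a*x = 0 → a*r*x = 0`). -/
def PointwiseSemicommutative (R : Type*) [Ring R] : Prop :=
  ∀ a : R, (∀ x r : R, x * a = 0 → x * r * a = 0) ∨ (∀ x r : R, a * x = 0 → a * r * x = 0)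

/-- A pointwise semicommutative ring is directly finite. -/
theorem directlyFinite_of_pointwiseSemicommutative (R : Type*) [Ring R]
    (hR : PointwiseSemicommutative R) :
    ∀ w h : R, w * h = 1 → h * w = 1 := by
  intro w h hwh
  have he : h * w * (h * w) = h * w := by
    rw [mul_assoc, ← mul_assoc w, hwh, one_mul]
  suffices hf : 1 - h * w = 0 from (sub_eq_zero.mp hf).symm
  rcases hR (h * w) with hl | hr
  · have hz : (1 - h * w) * w * (h * w) = 0 := hl _ w (by rw [sub_mul, one_mul, he, sub_self])
    calc 1 - h * w = (1 - h * w) * (w * h) * (w * h) := by rw [hwh, mul_one, mul_one]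
      _ = (1 - h * w) * w * (h * w) * h := by simp only [mul_assoc]
      _ = 0 := by rw [hz, zero_mul]
  · have hz : h * w * h * (1 - h * w) = 0 := hr _ h (by rw [mul_sub, mul_one, he, sub_self])
    calc 1 - h * w = w * h * (w * h) * (1 - h * w) := by rw [hwh, one_mul, one_mul]
      _ = w * (h * w * h * (1 - h * w)) := by simp only [mul_assoc]
      _ = 0 := by rw [hz, mul_zero]
end

section
/- Let R be a pointwise semicommutative ring. Then R is left min-abel, i.e., for every idempotent e ∈ R such that Re is a minimal left ideal of R, one has r·e = e·r·e for all r ∈ R. -/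
/-- A pointwise semicommutative ring is left min-abel: for every idempotent `e` such that
`Re` is a minimal left ideal, `r * e = e * r * e` for all `r`. -/
theorem leftMinAbel_of_pointwiseSemicommutative (R : Type*) [Ring R]
    (hR : PointwiseSemicommutative R) (e : R) (he : e * e = e)
    (hne : Submodule.span R {e} ≠ (⊥ : Submodule R R))
    (hmin : ∀ L : Submodule R R, L ≤ Submodule.span R {e} →
      L = ⊥ ∨ L = Submodule.span R {e}) :
    ∀ r : R, r * e = e * r * e := by
  intro r
  rcases hR e with h | h
  · have h1 := h (1 - e) r (by rw [sub_mul, one_mul, he, sub_self])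
    rwa [sub_mul, one_mul, sub_mul, sub_eq_zero] at h1
  · have hea : e * (r * e - e * r * e) = 0 := by
      simp only [mul_sub, ← mul_assoc, he, sub_self]
    have hle : Submodule.span R {r * e - e * r * e} ≤ Submodule.span R {e} := by
      rw [Submodule.span_singleton_le_iff_mem, Submodule.mem_span_singleton]
      exact ⟨r - e * r, sub_mul _ _ _⟩
    rcases hmin _ hle with h0 | h0
    · exact sub_eq_zero.mp (Submodule.span_singleton_eq_bot.mp h0)
    · have hmem := h0.ge (Submodule.mem_span_singleton_self e)
      obtain ⟨c, hc⟩ := Submodule.mem_span_singleton.mp hmem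
      have he0 := h _ c hea
      rw [mul_assoc, ← smul_eq_mul c, hc, he] at he0
      exact absurd (Submodule.span_singleton_eq_bot.mpr he0) hne
end

section
/- Let R be a pointwise semicommutative ring. Then R is NCI, i.e., either R has no nonzero nilpotent elements, or there exists a nonzero two-sided ideal of R all of whose elements are nilpotent. -/
/-- If `a * r * a = 0` for all `r`, then `y * r * x = 0` for all `r` and all `x`, `y` in the
two-sided ideal generated by `a`. -/
theorem TwoSidedIdeal.mul_mul_eq_zero_of_mem_span_singleton {R : Type*} [Ring R] {a : R}
    (ha : ∀ r : R, a * r * a = 0) {x y : R} (hx : x ∈ TwoSidedIdeal.span {a})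
    (hy : y ∈ TwoSidedIdeal.span {a}) (r : R) : y * r * x = 0 := by
  have hax : ∀ r, a * r * x = 0 := by
    induction hx using TwoSidedIdeal.span_induction with
    | mem x h => rwa [Set.mem_singleton_iff.mp h]
    | zero => simp
    | add x z _ _ h₁ h₂ => simp [mul_add, h₁, h₂]
    | neg x _ h => simp [h]
    | left_absorb b x _ h => exact fun r => by rw [← mul_assoc, mul_assoc a, h]
    | right_absorb b x _ h => exact fun r => by rw [← mul_assoc, h, zero_mul]
  induction hy using TwoSidedIdeal.span_induction generalizing r with
  | mem y h => rw [Set.mem_singleton_iff.mp h, hax]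
  | zero => simp
  | add y z _ _ h₁ h₂ => simp [add_mul, h₁, h₂]
  | neg y _ h => simp [h]
  | left_absorb b y _ h => rw [mul_assoc b, mul_assoc b, h, mul_zero]
  | right_absorb b y _ h => rw [mul_assoc y, h]

/-- In a pointwise semicommutative ring, `a * a = 0` implies `a * r * a = 0` for all `r`. -/
theorem PointwiseSemicommutative.mul_mul_self_eq_zero {R : Type*} [Ring R]
    (hR : PointwiseSemicommutative R) {a : R} (ha : a * a = 0) (r : R) : a * r * a = 0 :=
  (hR a).elim (fun h => h a r ha) (fun h => h a r ha)

/-- A pointwise semicommutative ring is NCI: either it has no nonzero nilpotent elements,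
or there is a nonzero two-sided ideal all of whose elements are nilpotent. -/
theorem nci_of_pointwiseSemicommutative (R : Type*) [Ring R]
    (hR : PointwiseSemicommutative R) :
    (∀ a : R, IsNilpotent a → a = 0) ∨
      ∃ I : TwoSidedIdeal R, I ≠ ⊥ ∧ ∀ x ∈ I, IsNilpotent x := by
  by_cases hred : IsReduced R
  · exact Or.inl hred.eq_zero
  · right
    rw [isReduced_iff_pow_one_lt 2 one_lt_two] at hred
    push Not at hred
    obtain ⟨a, ha, ha0⟩ := hred
    have haRa := hR.mul_mul_self_eq_zero (pow_two a ▸ ha)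
    refine ⟨TwoSidedIdeal.span {a}, fun hbot => ha0 ?_, fun x hx => ⟨2, ?_⟩⟩
    · rw [← TwoSidedIdeal.mem_bot, ← hbot]
      exact TwoSidedIdeal.subset_span (Set.mem_singleton a)
    · simpa [pow_two] using
        TwoSidedIdeal.mul_mul_eq_zero_of_mem_span_singleton haRa hx hx 1
end

section
/- Let R be a pointwise semicommutative ring in which every nilpotent element w satisfies w² = 0. Then R is 2-primal, i.e., the set N(R) of nilpotent elements of R coincides with the prime radical P(R), the intersection of all prime two-sided ideals of R. -/
/-- The elements `v` with `x * r * v ∈ P` for all `r`, as a two-sided ideal. -/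
def TwoSidedIdeal.rightResidual {R : Type*} [Ring R] (P : TwoSidedIdeal R) (x : R) :
    TwoSidedIdeal R :=
  .mk' {v | ∀ r : R, x * r * v ∈ P}
    (fun r => by simp)
    (fun hu hv r => by simpa [mul_add] using P.add_mem (hu r) (hv r))
    (fun hv r => by simpa using P.neg_mem (hv r))
    (fun {u v} hv r => by simpa [mul_assoc] using hv (r * u))
    (fun {u v} hu r => by simpa [mul_assoc] using P.mul_mem_right _ v (hu r))

/-- The elements `u` with `u * r * y ∈ P` for all `r`, as a two-sided ideal. -/
def TwoSidedIdeal.leftResidual {R : Type*} [Ring R] (P : TwoSidedIdeal R) (y : R) :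
    TwoSidedIdeal R :=
  .mk' {u | ∀ r : R, u * r * y ∈ P}
    (fun r => by simp)
    (fun hu hv r => by simpa [add_mul] using P.add_mem (hu r) (hv r))
    (fun hv r => by simpa using P.neg_mem (hv r))
    (fun {u v} hv r => by simpa [mul_assoc] using P.mul_mem_left u _ (hv r))
    (fun {u v} hu r => by simpa [mul_assoc] using hu (v * r))

theorem TwoSidedIdeal.mem_rightResidual {R : Type*} [Ring R] {P : TwoSidedIdeal R} {x v : R} :
    v ∈ P.rightResidual x ↔ ∀ r : R, x * r * v ∈ P :=
  TwoSidedIdeal.mem_mk' ..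

theorem TwoSidedIdeal.mem_leftResidual {R : Type*} [Ring R] {P : TwoSidedIdeal R} {y u : R} :
    u ∈ P.leftResidual y ↔ ∀ r : R, u * r * y ∈ P :=
  TwoSidedIdeal.mem_mk' ..

/-- A nonempty chain of two-sided ideals is bounded above by an ideal contained in its union. -/
theorem TwoSidedIdeal.exists_upperBound_of_isChain {R : Type*} [Ring R]
    {c : Set (TwoSidedIdeal R)} (hc : IsChain (· ≤ ·) c) (hne : c.Nonempty) :
    ∃ U : TwoSidedIdeal R, (∀ I ∈ c, I ≤ U) ∧ ∀ x ∈ U, ∃ I ∈ c, x ∈ I := by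
  let U : TwoSidedIdeal R := .mk' {x | ∃ I ∈ c, x ∈ I}
    (hne.imp fun I hI => ⟨hI, I.zero_mem⟩)
    (by
      rintro x y ⟨I, hI, hx⟩ ⟨J, hJ, hy⟩
      rcases hc.total hI hJ with h | h
      · exact ⟨J, hJ, J.add_mem (h hx) hy⟩
      · exact ⟨I, hI, I.add_mem hx (h hy)⟩)
    (fun ⟨I, hI, hx⟩ => ⟨I, hI, I.neg_mem hx⟩)
    (fun {x y} ⟨I, hI, hy⟩ => ⟨I, hI, I.mul_mem_left x y hy⟩)
    (fun {x y} ⟨I, hI, hx⟩ => ⟨I, hI, I.mul_mem_right x y hx⟩)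
  have hU (x : R) : x ∈ U ↔ ∃ I ∈ c, x ∈ I := TwoSidedIdeal.mem_mk' ..
  exact ⟨U, fun I hI x hx => (hU x).2 ⟨I, hI, hx⟩, fun x => (hU x).1⟩

/-- A two-sided ideal maximal among those containing no power of `a` is prime. -/
theorem TwoSidedIdeal.mem_or_mem_of_maximal_disjoint_powers {R : Type*} [Ring R] {a : R}
    {P : TwoSidedIdeal R} (hP : Maximal (fun I : TwoSidedIdeal R => ∀ n : ℕ, a ^ n ∉ I) P)
    {x y : R} (hxy : ∀ r : R, x * r * y ∈ P) : x ∈ P ∨ y ∈ P := by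
  have exists_pow {I : TwoSidedIdeal R} (hI : P ≤ I) {z : R} (hz : z ∈ I) (hzP : z ∉ P) :
      ∃ n : ℕ, a ^ n ∈ I := by
    by_contra! h
    exact hzP (hP.le_of_ge h hI hz)
  by_contra! hxyP
  obtain ⟨n, hn⟩ := exists_pow (I := P.rightResidual x)
    (fun v hv => mem_rightResidual.2 fun r => P.mul_mem_left _ _ hv)
    (mem_rightResidual.2 hxy) hxyP.2
  obtain ⟨m, hm⟩ := exists_pow (I := P.leftResidual (a ^ n))
    (fun u hu => mem_leftResidual.2 fun r => P.mul_mem_right _ _ (P.mul_mem_right _ _ hu))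
    (mem_leftResidual.2 (mem_rightResidual.1 hn)) hxyP.1
  apply hP.prop (m + n)
  simpa [pow_add] using mem_leftResidual.1 hm 1

/-- An element lying in every prime two-sided ideal is nilpotent. -/
theorem isNilpotent_of_forall_mem_prime {R : Type*} [Ring R] {a : R}
    (ha : ∀ P : TwoSidedIdeal R, P ≠ ⊤ →
      (∀ x y : R, (∀ r : R, x * r * y ∈ P) → x ∈ P ∨ y ∈ P) → a ∈ P) :
    IsNilpotent a := by
  by_contra hnil
  have hbot : ∀ n : ℕ, a ^ n ∉ (⊥ : TwoSidedIdeal R) := fun n hn =>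
    hnil ⟨n, by simpa using hn⟩
  obtain ⟨P, -, hP⟩ := zorn_le_nonempty₀ {I : TwoSidedIdeal R | ∀ n : ℕ, a ^ n ∉ I}
    (fun c hcS hc I hI => by
      obtain ⟨U, hcU, hU⟩ := TwoSidedIdeal.exists_upperBound_of_isChain hc ⟨I, hI⟩
      refine ⟨U, fun n hn => ?_, hcU⟩
      obtain ⟨J, hJ, hnJ⟩ := hU _ hn
      exact hcS hJ n hnJ) ⊥ hbot
  refine hP.prop 1 ?_
  rw [pow_one]
  refine ha P ?_ fun x y => TwoSidedIdeal.mem_or_mem_of_maximal_disjoint_powers hP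
  rintro rfl
  exact hP.prop 0 trivial

/-- A pointwise semicommutative ring in which every nilpotent element has index at most 2
is 2-primal: the set of nilpotent elements coincides with the prime radical, the
intersection of all prime two-sided ideals. -/
theorem twoPrimal_of_pointwiseSemicommutative (R : Type*) [Ring R]
    (hR : PointwiseSemicommutative R)
    (h2 : ∀ w : R, IsNilpotent w → w * w = 0) :
    {a : R | IsNilpotent a} =
      {a : R | ∀ P : TwoSidedIdeal R, P ≠ ⊤ →
        (∀ x y : R, (∀ r : R, x * r * y ∈ P) → x ∈ P ∨ y ∈ P) → a ∈ P} := by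
  ext a
  refine ⟨fun ha P _ hP => ?_, isNilpotent_of_forall_mem_prime⟩
  have haa : a * a = 0 := h2 a ha
  have hara (r : R) : a * r * a = 0 := (hR a).elim (fun h => h a r haa) (fun h => h a r haa)
  exact (hP a a fun r => hara r ▸ P.zero_mem).elim id id
end

section
/- Let R be a pointwise semicommutative exchange ring. Then R is clean, i.e., every element of R is a sum of a unit and an idempotent. -/
section

variable {R : Type*} [Ring R]

theorem Ideal.isUnit_of_sub_one_mem_jacobson_bot' {r : R}
    (h : r - 1 ∈ Ideal.jacobson (⊥ : Ideal R)) : IsUnit r := by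
  obtain ⟨s, hs⟩ := Ideal.exists_mul_sub_mem_of_sub_one_mem_jacobson r h
  replace hs : s * r = 1 := sub_eq_zero.1 hs
  have hs' : s - 1 ∈ Ideal.jacobson (⊥ : Ideal R) := by
    have : s - 1 = -(s * (r - 1)) := by rw [mul_sub, hs, mul_one, neg_sub]
    rw [this]
    exact neg_mem (Ideal.mul_mem_left _ s h)
  obtain ⟨t, ht⟩ := Ideal.exists_mul_sub_mem_of_sub_one_mem_jacobson s hs'
  replace ht : t * s = 1 := sub_eq_zero.1 ht
  have hrt : t = r := left_inv_eq_right_inv ht hs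
  exact ⟨⟨r, s, hrt ▸ ht, hs⟩, rfl⟩

theorem Ideal.isUnit_of_isUnit_mk_jacobson_bot {u : R}
    (h : IsUnit (Ideal.Quotient.mk (Ideal.jacobson (⊥ : Ideal R)) u)) : IsUnit u := by
  obtain ⟨q, hl, hr⟩ := isUnit_iff_exists.1 h
  obtain ⟨v, rfl⟩ := Ideal.Quotient.mk_surjective q
  rw [← map_mul, ← map_one (Ideal.Quotient.mk _), Ideal.Quotient.mk_eq_mk_iff_sub_mem] at hl hr
  obtain ⟨a, ha⟩ := (Ideal.isUnit_of_sub_one_mem_jacobson_bot' hl).exists_right_inv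
  obtain ⟨b, hb⟩ := (Ideal.isUnit_of_sub_one_mem_jacobson_bot' hr).exists_left_inv
  rw [mul_assoc] at ha
  rw [← mul_assoc] at hb
  exact isUnit_iff_exists_and_exists.2 ⟨⟨_, ha⟩, ⟨_, hb⟩⟩

theorem Ideal.mem_jacobson_bot_of_mul_mul_self_eq_zero {z : R} (hz : ∀ r, z * r * z = 0) :
    z ∈ Ideal.jacobson (⊥ : Ideal R) := by
  refine Ideal.mem_jacobson_iff.2 fun y ↦ ⟨1 - y * z, ?_⟩
  rw [Submodule.mem_bot]
  linear_combination (norm := noncomm_ring) -y * hz y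

/-- Idempotents of a pointwise semicommutative ring are left or right semicentral. -/
theorem PointwiseSemicommutative.semicentral (hR : PointwiseSemicommutative R) {e : R}
    (he : IsIdempotentElem e) :
    (∀ r, (1 - e) * r * e = 0) ∨ (∀ r, e * r * (1 - e) = 0) :=
  (hR e).imp (fun h r ↦ h _ r he.one_sub_mul_self) (fun h r ↦ h _ r he.mul_one_sub_self)

theorem PointwiseSemicommutative.commute_mk_jacobson_bot (hR : PointwiseSemicommutative R)
    {e : R} (he : IsIdempotentElem e) (q : R ⧸ Ideal.jacobson (⊥ : Ideal R)) :
    Commute (Ideal.Quotient.mk (Ideal.jacobson (⊥ : Ideal R)) e) q := by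
  obtain ⟨r, rfl⟩ := Ideal.Quotient.mk_surjective q
  rw [Commute, SemiconjBy, ← map_mul, ← map_mul, Ideal.Quotient.mk_eq_mk_iff_sub_mem]
  apply Ideal.mem_jacobson_bot_of_mul_mul_self_eq_zero
  intro s
  rcases hR.semicentral he with h | h
  · have hz : e * r - r * e = e * r * (1 - e) := by
      linear_combination (norm := noncomm_ring) -h r
    rw [hz]
    linear_combination (norm := noncomm_ring) e * r * h s * r * (1 - e)
  · have hz : e * r - r * e = -((1 - e) * r * e) := by
      linear_combination (norm := noncomm_ring) h r
    rw [hz]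
    linear_combination (norm := noncomm_ring) (1 - e) * r * h s * r * e

theorem mul_eq_of_commute_idempotent {a b e : R} (hab : a * b = e) (he : IsIdempotentElem e)
    (hb : b * e = b) (hec : ∀ r, Commute e r) (hc : ∀ r, Commute (b * a) r) : b * a = e :=
  calc b * a = b * a * e := by rw [mul_assoc, ← (hec a).eq, ← mul_assoc, hb]
    _ = a * (b * a) * b := by rw [← hab, ← mul_assoc, (hc a).eq]
    _ = e := by rw [← mul_assoc, hab, mul_assoc, hab, he.eq]

/-- Suitable exchange data for `w` whose associated idempotents are central exhibit
`w - (1 - e)` as a unit. -/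
theorem isUnit_sub_one_sub_of_commute {w x y e : R} (he : IsIdempotentElem e)
    (hwx : w * x = e) (hx : x * e = x) (hwy : (1 - w) * y = 1 - e) (hy : y * (1 - e) = y)
    (hec : ∀ r, Commute e r) (hxc : ∀ r, Commute (x * w) r)
    (hyc : ∀ r, Commute (y * (1 - w)) r) : IsUnit (w - (1 - e)) := by
  have hxw := mul_eq_of_commute_idempotent hwx he hx hec hxc
  have hyw := mul_eq_of_commute_idempotent hwy he.one_sub hy
    (fun r ↦ (Commute.one_left r).sub_left (hec r)) hyc
  have hex := (hec x).eq
  have hey := (hec y).eq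
  refine ⟨⟨w - (1 - e), x - y, ?_, ?_⟩, rfl⟩
  · linear_combination (norm := noncomm_ring) hwx + hwy + hex + hx - hey + hy
  · linear_combination (norm := noncomm_ring) hxw + hyw + hx + hy

end

/-- A pointwise semicommutative exchange ring is clean. -/
theorem clean_of_pointwiseSemicommutative_exchange (R : Type*) [Ring R]
    (hR : PointwiseSemicommutative R)
    (hex : ∀ w : R, ∃ e : R, e * e = e ∧ (∃ x : R, e = w * x) ∧
      (∃ y : R, 1 - e = (1 - w) * y)) :
    ∀ w : R, ∃ u e : R, IsUnit u ∧ e * e = e ∧ w = u + e := by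
  intro w
  obtain ⟨e, he, ⟨x, hx⟩, ⟨y, hy⟩⟩ := hex w
  replace he : IsIdempotentElem e := he
  refine ⟨w - (1 - e), 1 - e, ?_, he.one_sub, (sub_add_cancel _ _).symm⟩
  have hwx : w * (x * e) = e := by rw [← mul_assoc, ← hx, he.eq]
  have hwy : (1 - w) * (y * (1 - e)) = 1 - e := by rw [← mul_assoc, ← hy, he.one_sub.eq]
  have hxe : x * e * e = x * e := by rw [mul_assoc, he.eq]
  have hye : y * (1 - e) * (1 - e) = y * (1 - e) := by rw [mul_assoc, he.one_sub.eq]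
  generalize x * e = x' at hwx hxe
  generalize y * (1 - e) = y' at hwy hye
  have hf : IsIdempotentElem (x' * w) := by
    rw [IsIdempotentElem, mul_assoc, ← mul_assoc w, hwx, ← mul_assoc, hxe]
  have hg : IsIdempotentElem (y' * (1 - w)) := by
    rw [IsIdempotentElem, mul_assoc, ← mul_assoc (1 - w), hwy, ← mul_assoc, hye]
  apply Ideal.isUnit_of_isUnit_mk_jacobson_bot
  let π := Ideal.Quotient.mk (Ideal.jacobson (⊥ : Ideal R))
  simpa using isUnit_sub_one_sub_of_commute (w := π w) (x := π x') (y := π y') (e := π e)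
    (he.map π) (by simpa using congrArg π hwx) (by simpa using congrArg π hxe)
    (by simpa using congrArg π hwy) (by simpa using congrArg π hye)
    (hR.commute_mk_jacobson_bot he) (by simpa using hR.commute_mk_jacobson_bot hf)
    (by simpa using hR.commute_mk_jacobson_bot hg)
end

section
/- Let R be a pointwise semicommutative ring. If R is semiperiodic, then every nilpotent element of R lies in the Jacobson radical J(R), i.e., N(R) ⊆ J(R). -/
/-- A ring `R` is *semiperiodic* if for every `w ∈ R` outside `J(R) ∪ C(R)` there exist
positive integers `p` and `q` of opposite parity with `w ^ q - w ^ p` nilpotent. -/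
def Semiperiodic (R : Type*) [Ring R] : Prop :=
  ∀ w : R, w ∉ Ideal.jacobson (⊥ : Ideal R) → ¬(∀ r : R, w * r = r * w) →
    ∃ p q : ℕ, 0 < p ∧ 0 < q ∧ ((Even p ∧ Odd q) ∨ (Odd p ∧ Even q)) ∧
      IsNilpotent (w ^ q - w ^ p)

/-- A power of `1 - w * c` with `c` commuting with `w` is again of the form `1 - w * g`. -/
theorem Commute.exists_one_sub_mul_pow_eq {R : Type*} [Ring R] {w c : R} (hc : Commute c w)
    (k : ℕ) : ∃ g : R, Commute g w ∧ (1 - w * c) ^ k = 1 - w * g := by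
  induction k with
  | zero => exact ⟨0, Commute.zero_left w, by simp⟩
  | succ k ih =>
    obtain ⟨g, hg, h⟩ := ih
    refine ⟨g + c - g * w * c,
      (hg.add_left hc).sub_left ((hg.mul_left (Commute.refl w)).mul_left hc), ?_⟩
    rw [pow_succ, h]
    noncomm_ring

/-- If `w ^ q - w ^ p` is nilpotent with `0 < p < q`, then some power of `w` is a multiple of an
idempotent which is itself a multiple of `w`. -/
theorem exists_isIdempotentElem_of_isNilpotent_pow_sub_pow {R : Type*} [Ring R] {w : R} {p q : ℕ}
    (hp : 0 < p) (hpq : p < q) (h : IsNilpotent (w ^ q - w ^ p)) :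
    ∃ (e b : R) (n : ℕ), IsIdempotentElem e ∧ e = b * w ∧ w ^ n = w ^ n * e := by
  obtain ⟨k, hk⟩ := h
  obtain ⟨d, rfl⟩ := Nat.exists_eq_add_of_lt hpq
  obtain ⟨g, hg, hgk⟩ := ((Commute.refl w).pow_left d).exists_one_sub_mul_pow_eq (k + 1)
  obtain ⟨m, hm⟩ : ∃ m, p * (k + 1) = m + 1 := ⟨p * (k + 1) - 1, by
    have : 0 < p * (k + 1) := by positivity
    omega⟩
  have hfactor : w ^ p - w ^ (p + d + 1) = w ^ p * (1 - w * w ^ d) := by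
    rw [mul_sub, mul_one, ← pow_succ', ← pow_add, add_assoc]
  have hcomm : Commute (w ^ p) (1 - w * w ^ d) := by
    rw [← pow_succ']
    exact (Commute.one_right _).sub_right (Commute.pow_pow_self w p (d + 1))
  have hzero : w ^ (m + 1) * (1 - w * g) = 0 := by
    rw [← hm, pow_mul, ← hgk, ← hcomm.mul_pow, ← hfactor, ← neg_sub, neg_pow, pow_succ (_ - _), hk]
    simp
  have hstep : w ^ (m + 1) * (w * g) = w ^ (m + 1) := by
    rw [mul_sub, mul_one, sub_eq_zero] at hzero
    exact hzero.symm
  have habsorb : ∀ j : ℕ, w ^ (m + 1) * (w * g) ^ j = w ^ (m + 1) := by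
    intro j
    induction j with
    | zero => simp
    | succ j ih => rw [pow_succ (w * g), ← mul_assoc, ih, hstep]
  refine ⟨(w * g) ^ (m + 1), g ^ (m + 1) * w ^ m, m + 1, ?_, ?_, (habsorb _).symm⟩
  · have hpow : (w * g) ^ (m + 1) = g ^ (m + 1) * w ^ (m + 1) := by
      rw [← hg.eq, hg.mul_pow]
    unfold IsIdempotentElem
    nth_rewrite 1 [hpow]
    rw [mul_assoc, habsorb, hpow]
  · rw [mul_assoc, ← pow_succ, ← hg.mul_pow, hg.eq]

/-- In a pointwise semicommutative ring, a left multiple of a nilpotent element that is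
idempotent vanishes. -/
theorem PointwiseSemicommutative.eq_zero_of_isIdempotentElem_mul {R : Type*} [Ring R]
    (hR : PointwiseSemicommutative R) {a e y : R} (ha : IsNilpotent a)
    (he : IsIdempotentElem e) (hy : e = y * a) : e = 0 := by
  obtain ⟨n, hn⟩ := ha
  rcases hR e with h | h
  · have hs : ∀ r, r * e = e * r * e := fun r ↦ by
      have := h (1 - e) r (by rw [sub_mul, one_mul, he.eq, sub_self])
      rwa [sub_mul, sub_mul, one_mul, sub_eq_zero] at this
    have key : ∀ k : ℕ, e = y ^ k * (a ^ k * e) := by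
      intro k
      induction k with
      | zero => simp
      | succ k ih =>
        calc e = y ^ k * (a ^ k * e) := ih
          _ = y ^ k * (e * a ^ k * e) := by rw [hs]
          _ = y ^ k * (y * a * a ^ k * e) := by rw [← hy]
          _ = y ^ (k + 1) * (a ^ (k + 1) * e) := by
            rw [pow_succ, pow_succ' a]
            simp only [mul_assoc]
    rw [key n, hn]
    simp
  · have hs : ∀ r, e * r = e * r * e := fun r ↦ by
      have := h (1 - e) r (by rw [mul_sub, mul_one, he.eq, sub_self])
      rwa [mul_sub, mul_one, sub_eq_zero] at this
    have key : ∀ k : ℕ, e = e * y ^ k * a ^ k := by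
      intro k
      induction k with
      | zero => simp
      | succ k ih =>
        calc e = e * y ^ k * a ^ k := ih
          _ = e * y ^ k * e * a ^ k := by rw [← hs]
          _ = e * y ^ k * (y * a) * a ^ k := by rw [← hy]
          _ = e * y ^ (k + 1) * a ^ (k + 1) := by
            rw [pow_succ, pow_succ' a]
            simp only [mul_assoc]
    rw [key n, hn, mul_zero]

/-- A central product `y * a` with `a` nilpotent is nilpotent. -/
theorem isNilpotent_mul_of_mul_central {R : Type*} [Ring R] {a y : R} (ha : IsNilpotent a)
    (hc : ∀ r : R, y * a * r = r * (y * a)) : IsNilpotent (y * a) := by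
  obtain ⟨n, hn⟩ := ha
  have key : ∀ k : ℕ, (y * a) ^ k = y ^ k * a ^ k := by
    intro k
    induction k with
    | zero => simp
    | succ k ih =>
      rw [pow_succ, ih, mul_assoc, ← hc, pow_succ, pow_succ' a]
      simp only [mul_assoc]
  exact ⟨n, by rw [key, hn, mul_zero]⟩

/-- In a pointwise semicommutative ring, if `a` is nilpotent and `w = y * a` has two distinct
positive powers with nilpotent difference, then `w` is nilpotent. -/
theorem PointwiseSemicommutative.isNilpotent_mul_of_pow_sub_pow {R : Type*} [Ring R]
    (hR : PointwiseSemicommutative R) {a y : R} (ha : IsNilpotent a) {p q : ℕ}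
    (hp : 0 < p) (hpq : p < q) (h : IsNilpotent ((y * a) ^ q - (y * a) ^ p)) :
    IsNilpotent (y * a) := by
  obtain ⟨e, b, n, he, hb, hn⟩ := exists_isIdempotentElem_of_isNilpotent_pow_sub_pow hp hpq h
  have he0 : e = 0 :=
    hR.eq_zero_of_isIdempotentElem_mul ha he (hb.trans (mul_assoc b y a).symm)
  exact ⟨n, by rw [hn, he0, mul_zero]⟩

/-- In a pointwise semicommutative semiperiodic ring, every nilpotent element lies in the
Jacobson radical. -/
theorem nilpotent_mem_jacobson_of_pointwiseSemicommutative_semiperiodic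
    (R : Type*) [Ring R] (hR : PointwiseSemicommutative R) (hsp : Semiperiodic R) :
    ∀ a : R, IsNilpotent a → a ∈ Ideal.jacobson (⊥ : Ideal R) := by
  intro a ha
  rw [Ideal.mem_jacobson_iff]
  intro y
  by_cases hJ : y * a ∈ Ideal.jacobson (⊥ : Ideal R)
  · obtain ⟨z, hz⟩ := Ideal.mem_jacobson_iff.mp hJ 1
    exact ⟨z, by rwa [mul_one, ← mul_assoc] at hz⟩
  have hnil : IsNilpotent (y * a) := by
    by_cases hC : ∀ r : R, y * a * r = r * (y * a)
    · exact isNilpotent_mul_of_mul_central ha hC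
    obtain ⟨p, q, hp, hq, hpar, h⟩ := hsp _ hJ hC
    have hne : p ≠ q := by
      rintro rfl
      rcases hpar with ⟨h₁, h₂⟩ | ⟨h₁, h₂⟩ <;> exact (Nat.not_even_iff_odd.mpr ‹Odd p›) ‹Even p›
    rcases hne.lt_or_gt with hlt | hlt
    · exact hR.isNilpotent_mul_of_pow_sub_pow ha hp hlt h
    · exact hR.isNilpotent_mul_of_pow_sub_pow ha hq hlt (by rw [← neg_sub]; exact h.neg)
  obtain ⟨z, hz⟩ := hnil.isUnit_one_add.exists_left_inv
  exact ⟨z, by rw [Ideal.mem_bot, ← hz]; noncomm_ring⟩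
end

section
/- Let R be a pointwise semicommutative ring. If R is semiperiodic, then the quotient ring R/J(R) by the Jacobson radical is commutative. -/
open Polynomial in
/-- If a product of linear polynomials evaluated at an endomorphism kills a nonzero vector, then
one of the roots is an eigenvalue. -/
theorem exists_eigenvector_of_aeval_prod_eq_zero {F V : Type*} [Field F] [AddCommGroup V]
    [Module F V] (d : Module.End F V) (s : Multiset F) (y : V) (hy : y ≠ 0)
    (h : aeval d (s.map fun μ => X - C μ).prod y = 0) :
    ∃ μ ∈ s, ∃ b : V, b ≠ 0 ∧ d b = μ • b := by
  induction s using Multiset.induction_on with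
  | empty => simp at h; exact absurd h hy
  | cons μ s ih =>
    by_cases h0 : aeval d (s.map fun μ => X - C μ).prod y = 0
    · obtain ⟨ν, hν, b, hb⟩ := ih h0
      exact ⟨ν, Multiset.mem_cons_of_mem hν, b, hb⟩
    · refine ⟨μ, Multiset.mem_cons_self μ s, _, h0, ?_⟩
      rw [Multiset.map_cons, Multiset.prod_cons, map_mul, Module.End.mul_apply] at h
      simpa [sub_eq_zero] using h

open Polynomial in
/-- If the image of an element of a finite field in a ring is not central, then the associated
inner derivation has an eigenvector with nonzero eigenvalue in that field. -/
theorem exists_eigenvector_innerDerivation {F D : Type*} [Field F] [Finite F] [Ring D]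
    (f : F →+* D) (α : F) (x : D) (hx : f α * x ≠ x * f α) :
    ∃ μ : F, μ ≠ 0 ∧ ∃ b : D, b ≠ 0 ∧ f α * b - b * f α = f μ * b := by
  classical
  cases nonempty_fintype F
  let : Module F D := Module.compHom D f
  have smul_eq (c : F) (v : D) : c • v = f c * v := rfl
  let R : Module.End F D :=
    { toFun := fun v => v * f α
      map_add' := fun u v => add_mul u v _
      map_smul' := fun c v => by simp [smul_eq, mul_assoc] }
  have hRpow (n : ℕ) (v : D) : (R ^ n) v = v * f α ^ n := by
    induction n generalizing v with
    | zero => simp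
    | succ n ih => rw [pow_succ, Module.End.mul_apply, ih, pow_succ', ← mul_assoc]; rfl
  let d : Module.End F D := algebraMap F (Module.End F D) α - R
  have hd (v : D) : d v = f α * v - v * f α := rfl
  have : Nontrivial D := ⟨⟨_, _, hx⟩⟩
  obtain ⟨p, hp⟩ := CharP.exists F
  obtain ⟨n, hprime, hcard⟩ := FiniteField.card F p
  have : Fact p.Prime := ⟨hprime⟩
  have : CharP (Module.End F D) p :=
    charP_of_injective_algebraMap (algebraMap F (Module.End F D)).injective p
  have hdq : d ^ Fintype.card F = d := by
    have hR : R ^ Fintype.card F = R := by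
      ext v
      rw [hRpow, ← map_pow, FiniteField.pow_card]
      rfl
    rw [hcard, sub_pow_char_pow_of_commute _ _ (Algebra.commutes α R), ← hcard, hR, ← map_pow,
      FiniteField.pow_card]
  have hprod : (Finset.univ.val.map fun μ : F => X - C μ).prod = X ^ Fintype.card F - X := by
    have hmonic : (X ^ Fintype.card F - X : F[X]).Monic :=
      monic_X_pow_sub (by rw [degree_X]; exact_mod_cast Fintype.one_lt_card)
    rw [← FiniteField.roots_X_pow_card_sub_X F]
    refine prod_multiset_X_sub_C_of_monic_of_roots_card_eq hmonic ?_
    rw [FiniteField.roots_X_pow_card_sub_X,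
      FiniteField.X_pow_card_sub_X_natDegree_eq _ Fintype.one_lt_card]
    rfl
  rw [← Multiset.cons_erase (Finset.mem_univ (0 : F)), Multiset.map_cons, Multiset.prod_cons]
    at hprod
  obtain ⟨μ, hμ, b, hb, hdb⟩ := exists_eigenvector_of_aeval_prod_eq_zero d
    ((Finset.univ : Finset F).val.erase 0) (d x) (by rwa [hd, sub_ne_zero]) (by
      have := congrArg (fun q => aeval d q x) hprod
      rw [mul_comm] at this
      simpa [hdq] using this)
  refine ⟨μ, ?_, b, hb, hdb⟩
  rintro rfl
  exact (Finset.univ : Finset F).nodup.notMem_erase hμ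

/-- If `b * a = a' * b` with `a'` in the subalgebra generated by `a`, and `a`, `b` are integral
over a finite ring, then `a` and `b` lie in a common finite subalgebra. -/
theorem exists_finite_subalgebra_of_skew_commute {k D : Type*} [CommRing k] [Finite k] [Ring D]
    [Algebra k D] {a b a' : D} (ha : IsIntegral k a) (hb : IsIntegral k b)
    (ha' : a' ∈ Algebra.adjoin k {a}) (hab : b * a = a' * b) :
    ∃ T : Subalgebra k D, Finite T ∧ a ∈ T ∧ b ∈ T := by
  set A := Algebra.adjoin k {a}
  set B := Algebra.adjoin k {b}
  have hAA : A.toSubmodule * A.toSubmodule = A.toSubmodule := A.isIdempotentElem_toSubmodule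
  have hBB : B.toSubmodule * B.toSubmodule = B.toSubmodule := B.isIdempotentElem_toSubmodule
  have hbA : ∀ x ∈ A, ∃ x' ∈ A, b * x = x' * b := by
    intro x hx
    induction hx using Algebra.adjoin_induction with
    | mem x hx => exact ⟨a', ha', by rw [Set.mem_singleton_iff.1 hx, hab]⟩
    | algebraMap r => exact ⟨_, A.algebraMap_mem r, (Algebra.commutes r b).symm⟩
    | add x y _ _ hx hy =>
      obtain ⟨x', hx', h1⟩ := hx
      obtain ⟨y', hy', h2⟩ := hy
      exact ⟨_, A.add_mem hx' hy', by rw [mul_add, add_mul, h1, h2]⟩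
    | mul x y _ _ hx hy =>
      obtain ⟨x', hx', h1⟩ := hx
      obtain ⟨y', hy', h2⟩ := hy
      exact ⟨_, A.mul_mem hx' hy', by rw [← mul_assoc, h1, mul_assoc, h2, mul_assoc]⟩
  have hBA : B.toSubmodule * A.toSubmodule ≤ A.toSubmodule * B.toSubmodule := by
    have key : ∀ y ∈ B, ∀ x ∈ A, y * x ∈ A.toSubmodule * B.toSubmodule := by
      intro y hy
      induction hy using Algebra.adjoin_induction with
      | mem y hy =>
        intro x hx
        obtain ⟨x', hx', h⟩ := hbA x hx
        rw [Set.mem_singleton_iff.1 hy, h]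
        exact Submodule.mul_mem_mul hx' (Algebra.self_mem_adjoin_singleton k b)
      | algebraMap r =>
        intro x hx
        rw [Algebra.commutes]
        exact Submodule.mul_mem_mul hx (B.algebraMap_mem r)
      | add y z _ _ hy hz =>
        intro x hx
        rw [add_mul]
        exact add_mem (hy x hx) (hz x hx)
      | mul y z _ _ hy hz =>
        intro x hx
        rw [mul_assoc]
        refine Submodule.mul_induction_on (C := fun w => y * w ∈ A.toSubmodule * B.toSubmodule)
          (hz x hx) ?_ ?_
        · intro u hu v hv
          rw [← mul_assoc, ← hBB, ← mul_assoc]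
          exact Submodule.mul_mem_mul (hy u hu) hv
        · intro u v hu hv
          rw [mul_add]
          exact add_mem hu hv
    exact Submodule.mul_le.2 key
  have hTT : A.toSubmodule * B.toSubmodule * (A.toSubmodule * B.toSubmodule) ≤
      A.toSubmodule * B.toSubmodule := calc
    _ = A.toSubmodule * (B.toSubmodule * A.toSubmodule) * B.toSubmodule := by
      simp only [mul_assoc]
    _ ≤ A.toSubmodule * (A.toSubmodule * B.toSubmodule) * B.toSubmodule := by gcongr
    _ = (A.toSubmodule * A.toSubmodule) * (B.toSubmodule * B.toSubmodule) := by
      simp only [mul_assoc]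
    _ = A.toSubmodule * B.toSubmodule := by rw [hAA, hBB]
  have h_one : (1 : D) ∈ A.toSubmodule * B.toSubmodule := by
    simpa using Submodule.mul_mem_mul (M := A.toSubmodule) (N := B.toSubmodule) A.one_mem B.one_mem
  have : Module.Finite k ↥(A.toSubmodule * B.toSubmodule) :=
    Module.Finite.iff_fg.2 (ha.fg_adjoin_singleton.mul hb.fg_adjoin_singleton)
  refine ⟨(A.toSubmodule * B.toSubmodule).toSubalgebra h_one
    fun x y hx hy => hTT (Submodule.mul_mem_mul hx hy),
    Module.finite_of_finite k (M := ↥(A.toSubmodule * B.toSubmodule)), ?_, ?_⟩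
  · simpa using Submodule.mul_mem_mul (M := A.toSubmodule) (N := B.toSubmodule)
      (Algebra.self_mem_adjoin_singleton k a) B.one_mem
  · simpa using Submodule.mul_mem_mul (M := A.toSubmodule) (N := B.toSubmodule)
      A.one_mem (Algebra.self_mem_adjoin_singleton k b)

/-- A division ring in which every noncentral element satisfies `w ^ (k + 1) = w` for some odd `k`
is commutative. -/
theorem DivisionRing.mul_comm_of_noncentral_pow_eq {D : Type*} [DivisionRing D]
    (h : ∀ w : D, (∀ r, w * r = r * w) ∨ ∃ k : ℕ, Odd k ∧ w ^ (k + 1) = w) (x y : D) :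
    x * y = y * x := by
  by_contra hxy
  have potent (w r : D) (hw : w * r ≠ r * w) : ∃ k : ℕ, Odd k ∧ w ^ k = 1 := by
    obtain hc | ⟨k, hk, hwk⟩ := h w
    · exact absurd (hc r) hw
    · have hw0 : w ≠ 0 := by rintro rfl; simp at hw
      exact ⟨k, hk, mul_right_cancel₀ hw0 (by rw [← pow_succ, hwk, one_mul])⟩
  have htwo : (2 : D) = 0 := by
    obtain ⟨l, hl, hxl⟩ := potent (-x) y (by simpa using hxy)
    by_contra h2
    obtain ⟨k, hk, hxk⟩ := potent x y hxy
    have h1 : x ^ (k * l) = 1 := by rw [pow_mul, hxk, one_pow]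
    have h3 : (-x) ^ (k * l) = 1 := by rw [mul_comm, pow_mul, hxl, one_pow]
    rw [(hk.mul hl).neg_pow, h1] at h3
    exact h2 (by rw [← one_add_one_eq_two, ← neg_eq_iff_add_eq_zero, h3])
  have : CharP D 2 := CharTwo.of_one_ne_zero_of_two_eq_zero one_ne_zero htwo
  let : Algebra (ZMod 2) D := ZMod.algebra D 2
  have integral (w r : D) (hw : w * r ≠ r * w) : IsIntegral (ZMod 2) w := by
    obtain ⟨k, hk, hwk⟩ := potent w r hw
    exact IsIntegral.of_pow hk.pos (hwk ▸ isIntegral_one)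
  have hx := integral x y hxy
  set K := Algebra.adjoin (ZMod 2) {x}
  have : Module.Finite (ZMod 2) K := Module.Finite.iff_fg.2 hx.fg_adjoin_singleton
  have : Finite K := Module.finite_of_finite (ZMod 2)
  let : Field K := (Finite.isDomain_to_isField K).toField
  obtain ⟨μ, hμ, b, hb, hdb⟩ := exists_eigenvector_innerDerivation K.val.toRingHom
    ⟨x, Algebra.self_mem_adjoin_singleton _ x⟩ y hxy
  change x * b - b * x = μ * b at hdb
  have hne : b * x ≠ x * b := by
    intro hcomm
    rw [hcomm, sub_self, eq_comm, mul_eq_zero] at hdb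
    exact hdb.elim (fun h0 => hμ (Subtype.ext h0)) hb
  obtain ⟨T, hT, hxT, hbT⟩ := exists_finite_subalgebra_of_skew_commute (k := ZMod 2)
    (a' := x - μ) hx (integral b x hne)
    (K.sub_mem (Algebra.self_mem_adjoin_singleton _ x) μ.2) (by rw [sub_mul, ← hdb]; abel)
  exact hne (congrArg Subtype.val
    ((Finite.isDomain_to_isField T).mul_comm ⟨b, hbT⟩ ⟨x, hxT⟩))

/-- In a pointwise semicommutative ring, compression by an idempotent is multiplicative. -/
theorem PointwiseSemicommutative.idempotent_compress_mul {R : Type*} [Ring R]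
    (hR : PointwiseSemicommutative R) {e : R} (he : IsIdempotentElem e) (x y : R) :
    e * (x * y) * e = e * x * e * y * e := by
  have h0 : (1 - e) * e = 0 := by rw [sub_mul, one_mul, he.eq, sub_self]
  have h1 : e * (1 - e) = 0 := by rw [mul_sub, mul_one, he.eq, sub_self]
  rcases hR e with h | h
  · have := h _ y h0
    rw [sub_mul, sub_mul, one_mul, sub_eq_zero] at this
    calc e * (x * y) * e = e * x * (y * e) := by simp only [mul_assoc]
      _ = e * x * e * y * e := by rw [this]; simp only [mul_assoc]
  · have := h _ x h1
    rw [mul_sub, mul_one, sub_eq_zero] at this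
    rw [← this, ← mul_assoc]

/-- In a pointwise semicommutative ring, an idempotent that is a left multiple of a nilpotent
element vanishes. -/
theorem PointwiseSemicommutative.eq_zero_of_idempotent_mul_nilpotent {R : Type*} [Ring R]
    (hR : PointwiseSemicommutative R) {a t : R} (ha : IsNilpotent a)
    (he : IsIdempotentElem (t * a)) : t * a = 0 := by
  obtain ⟨n, hn⟩ := ha
  set e := t * a with hta
  have key (n : ℕ) : e * (t ^ n * a ^ n) * e = e := by
    induction n with
    | zero => rw [pow_zero, pow_zero, mul_one, mul_one, he.eq]
    | succ n ih =>
      calc e * (t ^ (n + 1) * a ^ (n + 1)) * e = e * (t ^ n * (e * a ^ n)) * e := by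
            rw [pow_succ, pow_succ', hta]; simp only [mul_assoc]
        _ = e * t ^ n * e * (e * a ^ n) * e := hR.idempotent_compress_mul he _ _
        _ = e * t ^ n * e * a ^ n * e := by
            rw [← mul_assoc _ e, mul_assoc _ e e, he.eq]
        _ = e := by rw [← hR.idempotent_compress_mul he, ih]
  rw [← key n, hn, mul_zero, mul_zero, zero_mul]

/-- If `w ^ q - w ^ p` is nilpotent for some `p ≠ q`, then some power of `w` with exponent at
least two generates the same left ideal as an idempotent. -/
theorem exists_idempotent_of_isNilpotent_pow_sub_pow {R : Type*} [Ring R] {w : R} {p q : ℕ}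
    (hpq : p < q) (h : IsNilpotent (w ^ q - w ^ p)) :
    ∃ t : R, IsIdempotentElem (t * w ^ 2) ∧ (t * w ^ 2 = 0 → IsNilpotent w) := by
  obtain ⟨k, rfl⟩ := Nat.exists_eq_add_of_lt hpq
  obtain ⟨n, hn⟩ := h
  set u := w ^ (k + 1) with hu
  have hwu : Commute w u := Commute.pow_right rfl _
  have hfac : w ^ (p * n) * (1 - u) ^ n = 0 := by
    have hc : Commute (w ^ p) (1 - u) := (Commute.one_right _).sub_right (hwu.pow_left p)
    have h1 : w ^ (p + k + 1) - w ^ p = -(w ^ p * (1 - u)) := by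
      rw [mul_sub, mul_one, hu, ← pow_add, neg_sub, add_assoc]
    rw [h1, neg_pow, hc.mul_pow, ← pow_mul] at hn
    rcases neg_one_pow_eq_or R n with h2 | h2 <;> simpa [h2] using hn
  set G := ∑ i ∈ Finset.range n, (1 - u) ^ i
  have hG : u * G = 1 - (1 - u) ^ n := by
    simpa using mul_neg_geom_sum (1 - u) n
  set g := w ^ k * G
  have hwg : Commute w g := by
    refine (Commute.pow_right rfl k).mul_right (Commute.sum_right _ _ _ fun i _ => ?_)
    exact ((Commute.one_right _).sub_right hwu).pow_right i
  have hm0 : w ^ (p * n) = w ^ (p * n) * (w * g) := by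
    rw [← mul_assoc w, ← pow_succ', ← hu, hG, mul_sub, mul_one, hfac, sub_zero]
  set m := p * n + 2
  have hm : w ^ m = w ^ m * (w * g) := by
    have hc : Commute (w ^ 2) (w * g) :=
      ((Commute.refl w).mul_right hwg).pow_left 2
    rw [pow_add, mul_assoc, hc.eq, ← mul_assoc, ← hm0]
  have hiter (j : ℕ) : w ^ m = w ^ m * (w * g) ^ j := by
    induction j with
    | zero => simp
    | succ j ih => rw [pow_succ' (w * g), ← mul_assoc, ← hm, ← ih]
  have hgw : Commute (g ^ m) (w ^ m) := (hwg.pow_pow m m).symm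
  have he : g ^ m * w ^ (p * n) * w ^ 2 = g ^ m * w ^ m := by rw [mul_assoc, ← pow_add]
  have hmul : w ^ m * (g ^ m * w ^ m) = w ^ m := by
    rw [hgw.eq, ← hwg.mul_pow, ← hiter]
  refine ⟨g ^ m * w ^ (p * n), ?_, fun h0 => ⟨m, ?_⟩⟩
  · rw [he, IsIdempotentElem, mul_assoc, hmul]
  · rw [← hmul, ← he, h0, mul_zero]

namespace Semiperiodic

variable {R : Type*} [Ring R]

/-- In a semiperiodic ring, exponents of opposite parity can be ordered. -/
theorem exists_odd_add (hsp : Semiperiodic R) {w : R} (hw : w ∉ Ideal.jacobson (⊥ : Ideal R))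
    (hc : ¬∀ r : R, w * r = r * w) :
    ∃ p k : ℕ, 0 < p ∧ Odd k ∧ IsNilpotent (w ^ (p + k) - w ^ p) := by
  obtain ⟨p, q, hp, hq, hpar, hn⟩ := hsp w hw hc
  rcases lt_trichotomy p q with hlt | rfl | hlt
  · refine ⟨p, q - p, hp, ?_, by rwa [Nat.add_sub_cancel' hlt.le]⟩
    rw [Nat.odd_sub hlt.le]
    grind
  · grind
  · refine ⟨q, p - q, hq, ?_, ?_⟩
    · rw [Nat.odd_sub hlt.le]
      grind
    · rw [Nat.add_sub_cancel' hlt.le, ← neg_sub]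
      exact hn.neg

theorem exists_idempotent (hsp : Semiperiodic R) {w : R}
    (hw : w ∉ Ideal.jacobson (⊥ : Ideal R)) (hc : ¬∀ r : R, w * r = r * w) :
    ∃ t : R, IsIdempotentElem (t * w ^ 2) ∧ (t * w ^ 2 = 0 → IsNilpotent w) := by
  obtain ⟨p, k, -, hk, hn⟩ := hsp.exists_odd_add hw hc
  exact exists_idempotent_of_isNilpotent_pow_sub_pow (Nat.lt_add_of_pos_right hk.pos) hn

/-- Nilpotent elements of a pointwise semicommutative semiperiodic ring lie in the Jacobson
radical. -/
theorem mem_jacobson_of_isNilpotent (hsp : Semiperiodic R) (hR : PointwiseSemicommutative R)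
    {a : R} (ha : IsNilpotent a) : a ∈ Ideal.jacobson (⊥ : Ideal R) := by
  have of_nilpotent {w : R} (hw : IsNilpotent w) : ∃ z, z * w + z - 1 ∈ (⊥ : Ideal R) := by
    obtain ⟨z, hz⟩ := hw.isUnit_add_one.exists_left_inv
    exact ⟨z, by rw [Ideal.mem_bot, ← mul_add_one, hz, sub_self]⟩
  rw [Ideal.mem_jacobson_iff]
  intro y
  simp only [mul_assoc]
  by_cases hJ : y * a ∈ Ideal.jacobson (⊥ : Ideal R)
  · simpa using Ideal.mem_jacobson_iff.1 hJ 1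
  · refine of_nilpotent ?_
    by_cases hc : ∀ r : R, y * a * r = r * (y * a)
    · obtain ⟨n, hn⟩ := ha
      have key (n : ℕ) : (y * a) ^ n = y ^ n * a ^ n := by
        induction n with
        | zero => simp
        | succ n ih =>
          rw [pow_succ', ih, ← mul_assoc, hc, pow_succ y, pow_succ' a]
          simp only [mul_assoc]
      exact ⟨n, by rw [key, hn, mul_zero]⟩
    · obtain ⟨t, ht, h0⟩ := hsp.exists_idempotent hJ hc
      have heq : t * (y * a) ^ 2 = t * (y * a) * y * a := by simp only [pow_two, mul_assoc]
      rw [heq] at ht h0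
      exact h0 (hR.eq_zero_of_idempotent_mul_nilpotent ha ht)

/-- The Jacobson radical of a semiperiodic ring whose nilpotent elements it contains is
completely semiprime. -/
theorem mem_jacobson_of_sq_mem (hsp : Semiperiodic R)
    (hnil : ∀ a : R, IsNilpotent a → a ∈ Ideal.jacobson (⊥ : Ideal R)) {w : R}
    (hw : w ^ 2 ∈ Ideal.jacobson (⊥ : Ideal R)) : w ∈ Ideal.jacobson (⊥ : Ideal R) := by
  by_contra hJ
  by_cases hc : ∀ r : R, w * r = r * w
  · refine hJ (Ideal.mem_jacobson_iff.2 fun y => ?_)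
    obtain ⟨z, hz⟩ := Ideal.mem_jacobson_iff.1 hw (-y ^ 2)
    refine ⟨z * (1 - y * w), ?_⟩
    have h2 : y * w * (y * w) = y ^ 2 * w ^ 2 := by
      rw [mul_assoc, ← mul_assoc w, hc y]; simp only [pow_two, mul_assoc]
    have : z * (1 - y * w) * y * w + z * (1 - y * w) - 1 = z * -y ^ 2 * w ^ 2 + z - 1 := by
      calc _ = z + -(z * (y * w * (y * w))) - 1 := by noncomm_ring
        _ = _ := by rw [h2]; noncomm_ring
    rwa [this]
  · obtain ⟨t, ht, h0⟩ := hsp.exists_idempotent hJ hc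
    refine hJ (hnil w (h0 ?_))
    set e := t * w ^ 2
    have heJ : e ∈ Ideal.jacobson (⊥ : Ideal R) := Ideal.mul_mem_left _ t hw
    obtain ⟨z, hz⟩ := Ideal.mem_jacobson_iff.1 heJ (-1)
    have hz' : z * (1 - e) = 1 := by
      rw [← sub_eq_zero, ← Ideal.mem_bot]
      convert hz using 1
      noncomm_ring
    calc e = z * (1 - e) * e := by rw [hz', one_mul]
      _ = 0 := by rw [mul_assoc, sub_mul, one_mul, ht.eq, sub_self, mul_zero]

end Semiperiodic

/-- Idempotents of a reduced ring are central. -/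
theorem IsIdempotentElem.commute_of_isReduced {S : Type*} [Ring S] [IsReduced S] {e : S}
    (he : IsIdempotentElem e) (r : S) : e * r = r * e := by
  have h0 : (1 - e) * e = 0 := by rw [sub_mul, one_mul, he.eq, sub_self]
  have h1 : e * (1 - e) = 0 := by rw [mul_sub, mul_one, he.eq, sub_self]
  have h2 : e * r * (1 - e) = 0 := eq_zero_of_pow_eq_zero (n := 2) <| by
    rw [pow_two]
    calc _ = e * r * ((1 - e) * e) * r * (1 - e) := by simp only [mul_assoc]
      _ = 0 := by rw [h0]; simp
  have h3 : (1 - e) * r * e = 0 := eq_zero_of_pow_eq_zero (n := 2) <| by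
    rw [pow_two]
    calc _ = (1 - e) * r * (e * (1 - e)) * r * e := by simp only [mul_assoc]
      _ = 0 := by rw [h1]; simp
  rw [mul_sub, mul_one, sub_eq_zero] at h2
  rw [sub_mul, one_mul, sub_mul, sub_eq_zero] at h3
  rw [h2, h3]

/-- If a pointwise semicommutative ring is semiperiodic, then `R/J(R)` is commutative,
i.e. every additive commutator lies in the Jacobson radical. -/
theorem quotient_jacobson_commutative_of_pointwiseSemicommutative_semiperiodic
    (R : Type*) [Ring R] (hR : PointwiseSemicommutative R) (hsp : Semiperiodic R) :
    ∀ a b : R, a * b - b * a ∈ Ideal.jacobson (⊥ : Ideal R) := by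
  intro a b
  have hnil := fun a => hsp.mem_jacobson_of_isNilpotent hR (a := a)
  set J := Ideal.jacobson (⊥ : Ideal R) with hJ
  have : IsReduced (R ⧸ J) := by
    rw [isReduced_iff_pow_one_lt 2 one_lt_two]
    intro x hx
    obtain ⟨w, rfl⟩ := Ideal.Quotient.mk_surjective x
    rw [← map_pow, Ideal.Quotient.eq_zero_iff_mem] at hx
    exact Ideal.Quotient.eq_zero_iff_mem.2 (hsp.mem_jacobson_of_sq_mem hnil hx)
  have potent (w : R) : w ∈ J ∨ (∀ r, w * r = r * w) ∨
      ∃ k : ℕ, Odd k ∧ (Ideal.Quotient.mk J w) ^ (k + 1) = Ideal.Quotient.mk J w := by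
    by_cases hw : w ∈ J
    · exact .inl hw
    by_cases hc : ∀ r, w * r = r * w
    · exact .inr (.inl hc)
    obtain ⟨p, k, hp, hk, hn⟩ := hsp.exists_odd_add hw hc
    refine .inr (.inr ⟨k, hk, ?_⟩)
    have h0 := Ideal.Quotient.eq_zero_iff_mem.2 (hnil _ hn)
    set v := Ideal.Quotient.mk J w
    rw [map_sub, map_pow, map_pow] at h0
    have hc : Commute v (v ^ k - 1) := (Commute.pow_right rfl k).sub_right (Commute.one_right v)
    have h1 : v * (v ^ k - 1) = 0 := eq_zero_of_pow_eq_zero (n := p) <| by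
      obtain ⟨n, rfl⟩ := Nat.exists_eq_succ_of_ne_zero hp.ne'
      rw [hc.mul_pow, pow_succ' (v ^ k - 1), ← mul_assoc, mul_sub, mul_one, ← pow_add, h0,
        zero_mul]
    rwa [mul_sub, mul_one, sub_eq_zero, ← pow_succ'] at h1
  rw [hJ, Ideal.jacobson, Ideal.mem_sInf]
  rintro M ⟨-, hM⟩
  have hJM : J ≤ M := sInf_le ⟨bot_le, hM⟩
  have : M.IsTwoSided := ⟨fun {x} r hx => by
    obtain hxJ | hc | ⟨k, hk, hxk⟩ := potent x
    · exact hJM (Ideal.mul_mem_right r J hxJ)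
    · rw [hc]
      exact M.mul_mem_left r hx
    · have he : IsIdempotentElem (Ideal.Quotient.mk J x ^ k) := by
        obtain ⟨n, rfl⟩ := Nat.exists_eq_succ_of_ne_zero hk.pos.ne'
        rw [IsIdempotentElem, ← pow_add, show n + 1 + (n + 1) = n + (n + 1 + 1) by ring, pow_add,
          hxk, ← pow_succ]
      have h2 : Ideal.Quotient.mk J (x * r - x * r * x ^ k) = 0 := by
        rw [map_sub, map_mul, map_mul _ (x * r), map_pow, ← he.commute_of_isReduced,
          map_mul, ← mul_assoc, ← pow_succ, hxk, sub_self]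
      have h3 := hJM (Ideal.Quotient.eq_zero_iff_mem.1 h2)
      exact (Submodule.sub_mem_iff_left M
        (M.mul_mem_left (x * r) (M.pow_mem_of_mem hx k hk.pos))).1 h3⟩
  let : DivisionRing (R ⧸ M) := Ideal.Quotient.divisionRing M
  refine Ideal.Quotient.eq_zero_iff_mem.1 ?_
  rw [map_sub, map_mul, map_mul, sub_eq_zero]
  refine DivisionRing.mul_comm_of_noncentral_pow_eq (fun v => ?_) _ _
  obtain ⟨w, rfl⟩ := Ideal.Quotient.mk_surjective v
  obtain hw | hc | ⟨k, hk, hwk⟩ := potent w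
  · left
    intro r
    rw [Ideal.Quotient.eq_zero_iff_mem.2 (hJM hw), zero_mul, mul_zero]
  · left
    intro r
    obtain ⟨r, rfl⟩ := Ideal.Quotient.mk_surjective r
    rw [← map_mul, hc, map_mul]
  · right
    refine ⟨k, hk, ?_⟩
    rw [← map_pow, Ideal.Quotient.eq] at hwk ⊢
    exact hJM hwk
end

section
/- Let R be a pointwise semicommutative ring. If R is semiperiodic, then R is NI, i.e., the set N(R) of nilpotent elements of R is a two-sided ideal of R. -/
section

variable {R : Type*} [Ring R]

theorem exists_left_inv_one_add_of_mem_jacobson {j : R}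
    (hj : j ∈ Ideal.jacobson (⊥ : Ideal R)) : ∃ z : R, z * (1 + j) = 1 := by
  obtain ⟨z, hz⟩ := Ideal.mem_jacobson_iff.1 hj 1
  refine ⟨z, ?_⟩
  rw [Ideal.mem_bot, sub_eq_zero, mul_one] at hz
  rw [mul_add, mul_one, add_comm, hz]

theorem mem_jacobson_bot_of_left_inv {a : R}
    (h : ∀ r : R, ∃ z : R, z * (1 + r * a) = 1) : a ∈ Ideal.jacobson (⊥ : Ideal R) := by
  refine Ideal.mem_jacobson_iff.2 fun r => ?_
  obtain ⟨z, hz⟩ := h r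
  refine ⟨z, ?_⟩
  rw [Ideal.mem_bot, ← hz]
  noncomm_ring

theorem isNilpotent_of_mul_left_inv {y z c : R} (hyc : Commute y c) (hz : z * y = 1)
    (h : IsNilpotent (y * c)) : IsNilpotent c := by
  obtain ⟨n, hn⟩ := h
  have hzn : z ^ n * y ^ n = 1 := by
    clear hn
    induction n with
    | zero => simp
    | succ n ih =>
      rw [pow_succ, pow_succ', mul_assoc, ← mul_assoc z, hz, one_mul, ih]
  refine ⟨n, ?_⟩
  rw [hyc.mul_pow] at hn
  rw [← one_mul (c ^ n), ← hzn, mul_assoc, hn, mul_zero]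

theorem isNilpotent_mul_swap {a b : R} (h : IsNilpotent (a * b)) : IsNilpotent (b * a) := by
  obtain ⟨n, hn⟩ := h
  refine ⟨n + 1, ?_⟩
  have key : ∀ m : ℕ, (b * a) ^ (m + 1) = b * (a * b) ^ m * a := by
    intro m
    induction m with
    | zero => simp
    | succ m ih => rw [pow_succ, ih, pow_succ]; simp only [mul_assoc]
  rw [key, hn, mul_zero, zero_mul]

/-- In a pointwise semicommutative ring, a left multiple of a nilpotent element is idempotent
only if it vanishes. -/
theorem PointwiseSemicommutative.eq_zero_of_isIdempotentElem (hR : PointwiseSemicommutative R)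
    {e s a : R} (he : IsIdempotentElem e) (hesa : e = s * a) (ha : IsNilpotent a) : e = 0 := by
  have hee : e * e = e := he
  have key : ∀ n : ℕ, ∃ t : R, e = t * a ^ n * e := by
    intro n
    induction n with
    | zero => exact ⟨1, by simp⟩
    | succ n ih =>
      obtain ⟨t, ht⟩ := ih
      rcases hR e with h | h
      · have h1 : a ^ n * e = e * a ^ n * e := by
          have := h (1 - e) (a ^ n) (by rw [sub_mul, one_mul, hee, sub_self])
          rw [sub_mul, one_mul, sub_mul, sub_eq_zero] at this
          exact this
        refine ⟨t * s, ?_⟩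
        calc e = t * (a ^ n * e) := by rw [← mul_assoc, ← ht]
          _ = t * (e * a ^ n * e) := by rw [← h1]
          _ = t * (s * a * a ^ n * e) := by rw [← hesa]
          _ = t * s * a ^ (n + 1) * e := by rw [pow_succ']; simp only [mul_assoc]
      · have h1 : e * t = e * t * e := by
          have := h (1 - e) t (by rw [mul_sub, mul_one, hee, sub_self])
          rw [mul_sub, mul_one, sub_eq_zero] at this
          exact this
        refine ⟨e * t * s, ?_⟩
        calc e = e * (t * a ^ n * e) := by rw [← ht, hee]
          _ = e * t * (a ^ n * e) := by simp only [mul_assoc]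
          _ = e * t * e * (a ^ n * e) := by rw [← h1]
          _ = e * t * (s * a) * (a ^ n * e) := by rw [← hesa]
          _ = e * t * s * a ^ (n + 1) * e := by rw [pow_succ']; simp only [mul_assoc]
  obtain ⟨n, hn⟩ := ha
  obtain ⟨t, ht⟩ := key n
  rw [ht, hn, mul_zero, zero_mul]

open Polynomial in
theorem exists_pow_eq_pow_mul_of_isNilpotent {x : R} {p d : ℕ} (hd : 0 < d)
    (h : IsNilpotent (x ^ (p + d) - x ^ p)) :
    ∃ (k : ℕ) (t : R), 0 < k ∧ Commute x t ∧ x ^ k = x ^ k * (x * t) := by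
  obtain ⟨n, hn⟩ := h
  have hdvd : (X : ℤ[X]) ∣ 1 - (1 - X ^ d) ^ n := by
    have h1 := sub_dvd_pow_sub_pow (1 : ℤ[X]) (1 - X ^ d) n
    rw [one_pow, show (1 : ℤ[X]) - (1 - X ^ d) = X ^ d by ring] at h1
    exact (dvd_pow_self X hd.ne').trans h1
  obtain ⟨f, hf⟩ := hdvd
  have h0 : x ^ (p * n) * (1 - x * aeval x f) = 0 := by
    have h1 : (X : ℤ[X]) ^ (p * n) * (1 - X * f) = (-1) ^ n * (X ^ (p + d) - X ^ p) ^ n := by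
      rw [← hf, pow_mul, sub_sub_cancel, ← mul_pow, ← mul_pow]
      ring
    have h2 := congrArg (aeval x) h1
    simpa [hn] using h2
  have hc : Commute x (aeval x f) := by
    have := congrArg (aeval x) (mul_comm X f)
    simpa [Commute, SemiconjBy] using this
  refine ⟨p * n + 1, aeval x f, Nat.succ_pos _, hc, ?_⟩
  rw [mul_sub, mul_one, sub_eq_zero] at h0
  rw [pow_succ', mul_assoc, ← h0]

theorem PointwiseSemicommutative.isNilpotent_left_mul (hR : PointwiseSemicommutative R)
    {a r : R} (ha : IsNilpotent a) {p d : ℕ} (hd : 0 < d)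
    (h : IsNilpotent ((r * a) ^ (p + d) - (r * a) ^ p)) : IsNilpotent (r * a) := by
  obtain ⟨k, t, hk, hc, hkt⟩ := exists_pow_eq_pow_mul_of_isNilpotent hd h
  generalize hx : r * a = x at *
  have hpow : ∀ m : ℕ, x ^ k = x ^ k * (x * t) ^ m := by
    intro m
    induction m with
    | zero => simp
    | succ m ih => rw [pow_succ, ← mul_assoc, ← ih, ← hkt]
  have hxt : (x * t) ^ k = t ^ k * x ^ k := by rw [hc.mul_pow, (hc.pow_pow k k).eq]
  have hidem : IsIdempotentElem ((x * t) ^ k) := by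
    change (x * t) ^ k * (x * t) ^ k = (x * t) ^ k
    nth_rw 1 [hxt]
    rw [mul_assoc, ← hpow, ← hxt]
  have he : (x * t) ^ k = t ^ k * x ^ (k - 1) * r * a := by
    obtain ⟨m, rfl⟩ := Nat.exists_eq_add_of_lt hk
    rw [hxt, mul_assoc _ r a, hx, mul_assoc, ← pow_succ]
    simp
  refine ⟨k, ?_⟩
  rw [hpow k, hR.eq_zero_of_isIdempotentElem hidem he ha, mul_zero]

theorem Semiperiodic.exists_odd (hsp : Semiperiodic R) {w : R}
    (hJ : w ∉ Ideal.jacobson (⊥ : Ideal R)) (hC : ¬ ∀ r : R, w * r = r * w) :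
    ∃ p d : ℕ, Odd d ∧ IsNilpotent (w ^ (p + d) - w ^ p) := by
  obtain ⟨p, q, -, -, hpar, hn⟩ := hsp w hJ hC
  rcases le_total p q with h | h
  · obtain ⟨d, rfl⟩ := Nat.exists_eq_add_of_le h
    refine ⟨p, d, ?_, hn⟩
    simp only [Nat.even_iff, Nat.odd_iff] at *
    omega
  · obtain ⟨d, rfl⟩ := Nat.exists_eq_add_of_le h
    refine ⟨q, d, ?_, ?_⟩
    · simp only [Nat.even_iff, Nat.odd_iff] at *
      omega
    · rw [← neg_sub, isNilpotent_neg_iff]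
      exact hn

theorem mem_jacobson_of_isNilpotent (hR : PointwiseSemicommutative R)
    (hsp : Semiperiodic R) {a : R} (ha : IsNilpotent a) :
    a ∈ Ideal.jacobson (⊥ : Ideal R) := by
  refine mem_jacobson_bot_of_left_inv fun r => ?_
  by_cases hJ : r * a ∈ Ideal.jacobson (⊥ : Ideal R)
  · exact exists_left_inv_one_add_of_mem_jacobson hJ
  have hnil : IsNilpotent (r * a) := by
    by_cases hC : ∀ s : R, r * a * s = s * (r * a)
    · have key : ∀ m : ℕ, (r * a) ^ m = r ^ m * a ^ m := by
        intro m
        induction m with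
        | zero => simp
        | succ m ih =>
          rw [pow_succ', ih, ← mul_assoc, hC, pow_succ, pow_succ']
          simp only [mul_assoc]
      obtain ⟨n, hn⟩ := ha
      exact ⟨n, by rw [key, hn, mul_zero]⟩
    · obtain ⟨p, d, hd, hn⟩ := hsp.exists_odd hJ hC
      exact hR.isNilpotent_left_mul ha hd.pos hn
  exact hnil.isUnit_one_add.exists_left_inv

theorem pow_sub_pow_mem_of_commute {I : Ideal R} {x y : R} (hxy : Commute x y)
    (h : x - y ∈ I) (n : ℕ) : x ^ n - y ^ n ∈ I := by
  rw [← hxy.geom_sum₂_mul n]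
  exact I.mul_mem_left _ h

/-- A noncentral left invertible element of a semiperiodic ring has a unipotent power of odd
exponent. -/
theorem Semiperiodic.exists_odd_pow_sub_one (hsp : Semiperiodic R) {v z : R} (hz : z * v = 1)
    (hC : ¬ ∀ r : R, v * r = r * v) : ∃ d : ℕ, Odd d ∧ IsNilpotent (v ^ d - 1) := by
  have hJ : v ∉ Ideal.jacobson (⊥ : Ideal R) := by
    intro hv
    have h1 : (1 : R) ∈ Ideal.jacobson (⊥ : Ideal R) := hz ▸ Ideal.mul_mem_left _ z hv
    have hbot : (⊥ : Ideal R) = ⊤ :=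
      Ideal.jacobson_eq_top_iff.1 ((Ideal.eq_top_iff_one _).2 h1)
    have hzero : ∀ r : R, r = 0 := fun r => by
      have : r ∈ (⊥ : Ideal R) := hbot ▸ Submodule.mem_top
      simpa using this
    exact hC fun r => (hzero _).trans (hzero _).symm
  obtain ⟨p, d, hd, hn⟩ := hsp.exists_odd hJ hC
  refine ⟨d, hd, ?_⟩
  clear hJ
  have hcomm : Commute v (v ^ d - 1) :=
    ((Commute.refl v).pow_right d).sub_right (Commute.one_right v)
  have hn' : IsNilpotent (v ^ p * (v ^ d - 1)) := by rwa [mul_sub, ← pow_add, mul_one]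
  clear hn
  induction p with
  | zero => simpa using hn'
  | succ p ih =>
    apply ih
    rw [pow_succ', mul_assoc] at hn'
    exact isNilpotent_of_mul_left_inv
      (((Commute.refl v).pow_right p).mul_right hcomm) hz hn'

theorem isNilpotent_of_mem_jacobson_of_not_central (hR : PointwiseSemicommutative R)
    (hsp : Semiperiodic R) {j : R} (hj : j ∈ Ideal.jacobson (⊥ : Ideal R))
    (hC : ¬ ∀ r : R, j * r = r * j) : IsNilpotent j := by
  have h2 : (2 : R) ∈ Ideal.jacobson (⊥ : Ideal R) := by
    obtain ⟨z, hz⟩ := exists_left_inv_one_add_of_mem_jacobson (neg_mem hj)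
    have hz' : -z * (-1 + j) = 1 := by
      rw [neg_mul, ← mul_neg, neg_add, neg_neg, hz]
    obtain ⟨d, hd, hn⟩ := hsp.exists_odd_pow_sub_one hz' (by
      contrapose! hC
      intro r
      have := hC r
      rw [add_mul, mul_add] at this
      simpa using this)
    have h3 := mem_jacobson_of_isNilpotent hR hsp hn
    have h4 := pow_sub_pow_mem_of_commute (x := -1 + j) (y := -1)
      (Commute.neg_one_right _) (by simpa using hj) d
    rw [hd.neg_one_pow] at h4
    have h5 := sub_mem h4 h3
    have : (-1 + j) ^ d - -1 - ((-1 + j) ^ d - 1) = 2 := by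
      rw [sub_sub_sub_cancel_left, sub_neg_eq_add, one_add_one_eq_two]
    rwa [this] at h5
  obtain ⟨z, hz⟩ := exists_left_inv_one_add_of_mem_jacobson hj
  obtain ⟨d, hd, hn⟩ := hsp.exists_odd_pow_sub_one hz (by
    contrapose! hC
    intro r
    have := hC r
    rw [add_mul, mul_add] at this
    simpa using this)
  rw [← geom_sum_mul, add_sub_cancel_left] at hn
  have hsum : (∑ i ∈ Finset.range d, (1 + j) ^ i) - 1 ∈ Ideal.jacobson (⊥ : Ideal R) := by
    have h3 : ∑ i ∈ Finset.range d, ((1 + j) ^ i - 1) ∈ Ideal.jacobson (⊥ : Ideal R) :=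
      sum_mem fun i _ => by
        simpa using pow_sub_pow_mem_of_commute (x := 1 + j) (y := 1)
          (Commute.one_right _) (by simpa using hj) i
    obtain ⟨k, rfl⟩ := hd
    have h4 := add_mem h3 (Ideal.mul_mem_left _ (k : R) h2)
    convert h4 using 1
    rw [Finset.sum_sub_distrib]
    simp only [Finset.sum_const, Finset.card_range, nsmul_eq_mul, mul_one, Nat.cast_add,
      Nat.cast_mul, Nat.cast_ofNat, Nat.cast_one, (Nat.cast_commute k (2 : R)).eq]
    abel
  obtain ⟨y, hy⟩ := exists_left_inv_one_add_of_mem_jacobson hsum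
  rw [add_sub_cancel] at hy
  refine isNilpotent_of_mul_left_inv ?_ hy hn
  exact Commute.sum_left _ _ _ fun i _ =>
    ((Commute.one_left j).add_left (Commute.refl j)).pow_left i

/-- If the Jacobson radical is not central, then it is nil. -/
theorem isNilpotent_of_mem_jacobson (hR : PointwiseSemicommutative R) (hsp : Semiperiodic R)
    {j : R} (hj : j ∈ Ideal.jacobson (⊥ : Ideal R)) (hC : ¬ ∀ r : R, j * r = r * j)
    {c : R} (hc : c ∈ Ideal.jacobson (⊥ : Ideal R)) : IsNilpotent c := by
  by_cases hcC : ∀ r : R, c * r = r * c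
  · have h1 := isNilpotent_of_mem_jacobson_of_not_central hR hsp hj hC
    have h2 : IsNilpotent (c + j) := by
      refine isNilpotent_of_mem_jacobson_of_not_central hR hsp (add_mem hc hj) ?_
      contrapose! hC
      intro r
      have := hC r
      rw [add_mul, mul_add, hcC] at this
      exact add_left_cancel this
    have hcj : Commute (c + j) j := Commute.add_left (hcC j) (Commute.refl j)
    simpa using hcj.isNilpotent_sub h2 h1
  · exact isNilpotent_of_mem_jacobson_of_not_central hR hsp hc hcC

theorem isNilpotent_add_and_left_mul (hR : PointwiseSemicommutative R) (hsp : Semiperiodic R)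
    {a : R} (ha : IsNilpotent a) :
    (∀ b : R, IsNilpotent b → IsNilpotent (a + b)) ∧ ∀ r : R, IsNilpotent (r * a) := by
  have haJ := mem_jacobson_of_isNilpotent hR hsp ha
  by_cases hcen : ∀ j ∈ Ideal.jacobson (⊥ : Ideal R), ∀ r : R, j * r = r * j
  · have hac : ∀ r : R, Commute a r := hcen a haJ
    exact ⟨fun b hb => (hac b).isNilpotent_add ha hb,
      fun r => (hac r).symm.isNilpotent_mul_left ha⟩
  · push Not at hcen
    obtain ⟨j, hj, r₀, hr₀⟩ := hcen
    have hnil : ∀ c ∈ Ideal.jacobson (⊥ : Ideal R), IsNilpotent c := fun c hc =>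
      isNilpotent_of_mem_jacobson hR hsp hj (fun h => hr₀ (h r₀)) hc
    exact ⟨fun b hb => hnil _ (add_mem haJ (mem_jacobson_of_isNilpotent hR hsp hb)),
      fun r => hnil _ (Ideal.mul_mem_left _ r haJ)⟩

end

/-- A pointwise semicommutative semiperiodic ring is NI: the set of nilpotent elements is
a two-sided ideal. -/
theorem ni_of_pointwiseSemicommutative_semiperiodic
    (R : Type*) [Ring R] (hR : PointwiseSemicommutative R) (hsp : Semiperiodic R) :
    ∃ I : TwoSidedIdeal R, (I : Set R) = {a : R | IsNilpotent a} := by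
  refine ⟨TwoSidedIdeal.mk' {a : R | IsNilpotent a} IsNilpotent.zero
    (fun ha hb => (isNilpotent_add_and_left_mul hR hsp ha).1 _ hb) (fun ha => ha.neg)
    (fun ha => (isNilpotent_add_and_left_mul hR hsp ha).2 _)
    (fun ha => isNilpotent_mul_swap ((isNilpotent_add_and_left_mul hR hsp ha).2 _)), ?_⟩
  exact TwoSidedIdeal.coe_mk' _ _ _ _ _ _
end

section
/- Let R be a ring and S a multiplicatively closed subset of R consisting of central non-zero-divisors, and let S⁻¹R denote the localization of R at S. For any element u⁻¹a ∈ S⁻¹R (with u ∈ S, a ∈ R): the left annihilator of u⁻¹a is a two-sided ideal of S⁻¹R if and only if the left annihilator of a is a two-sided ideal of R, and the right annihilator of u⁻¹a is a two-sided ideal of S⁻¹R if and only if the right annihilator of a is a two-sided ideal of R. -/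
/-- A submonoid consisting of central elements is an Ore set. -/
def centralOreSet {R : Type*} [Ring R] (S : Submonoid R)
    (hcentral : ∀ s ∈ S, ∀ r : R, s * r = r * s) : OreLocalization.OreSet S where
  ore_right_cancel r₁ r₂ s h :=
    ⟨s, by rw [hcentral s s.2 r₁, hcentral s s.2 r₂, h]⟩
  oreNum r _ := r
  oreDenom _ s := s
  ore_eq r s := hcentral s s.2 r

theorem exists_twoSidedIdeal_eq_leftAnnihilator_iff {A : Type*} [Ring A] (b : A) :
    (∃ I : TwoSidedIdeal A, (I : Set A) = {x | x * b = 0}) ↔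
      ∀ x y : A, x * b = 0 → x * y * b = 0 := by
  constructor
  · rintro ⟨I, hI⟩ x y hx
    have hxI : x ∈ (I : Set A) := by rw [hI]; exact hx
    have hxy : x * y ∈ (I : Set A) := I.mul_mem_right x y hxI
    rwa [hI] at hxy
  · intro h
    refine ⟨TwoSidedIdeal.mk' {x | x * b = 0} (zero_mul b) ?_ ?_ ?_ ?_, TwoSidedIdeal.coe_mk' ..⟩
    · intro x y (hx : x * b = 0) (hy : y * b = 0)
      simp [add_mul, hx, hy]
    · intro x (hx : x * b = 0)
      simp [hx]
    · intro x y (hy : y * b = 0)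
      simp [mul_assoc, hy]
    · intro x y hx
      exact h x y hx

theorem exists_twoSidedIdeal_eq_rightAnnihilator_iff {A : Type*} [Ring A] (b : A) :
    (∃ I : TwoSidedIdeal A, (I : Set A) = {x | b * x = 0}) ↔
      ∀ x y : A, b * x = 0 → b * (y * x) = 0 := by
  constructor
  · rintro ⟨I, hI⟩ x y hx
    have hxI : x ∈ (I : Set A) := by rw [hI]; exact hx
    have hyx : y * x ∈ (I : Set A) := I.mul_mem_left y x hxI
    rwa [hI] at hyx
  · intro h
    refine ⟨TwoSidedIdeal.mk' {x | b * x = 0} (mul_zero b) ?_ ?_ ?_ ?_, TwoSidedIdeal.coe_mk' ..⟩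
    · intro x y (hx : b * x = 0) (hy : b * y = 0)
      simp [mul_add, hx, hy]
    · intro x (hx : b * x = 0)
      simp [hx]
    · intro x y hy
      exact h y x hy
    · intro x y (hx : b * x = 0)
      simp [← mul_assoc, hx]

theorem OreLocalization.oreDiv_mul_oreDiv_of_central {R : Type*} [Ring R] {S : Submonoid R}
    [OreLocalization.OreSet S] (hcentral : ∀ s ∈ S, ∀ r : R, s * r = r * s)
    (r₁ r₂ : R) (s₁ s₂ : S) :
    (r₁ /ₒ s₁) * (r₂ /ₒ s₂) = (r₁ * r₂) /ₒ (s₂ * s₁) :=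
  OreLocalization.oreDiv_mul_char r₁ r₂ s₁ s₂ r₁ s₂ (hcentral s₂ s₂.2 r₁)

theorem OreLocalization.oreDiv_eq_zero_iff {R : Type*} [Ring R] {S : Submonoid R}
    [OreLocalization.OreSet S] (hcentral : ∀ s ∈ S, ∀ r : R, s * r = r * s)
    (hS : ∀ s ∈ S, ∀ x : R, s * x = 0 → x = 0) (r : R) (s : S) :
    r /ₒ s = 0 ↔ r = 0 := by
  constructor
  · intro h
    rw [OreLocalization.zero_def, OreLocalization.oreDiv_eq_iff] at h
    obtain ⟨u, v, h, h'⟩ := h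
    simp only [smul_zero, OneMemClass.coe_one, mul_one, smul_eq_mul] at h h'
    refine hS u u.2 r ?_
    rw [h', mul_assoc, hcentral s s.2, ← mul_assoc, ← h, zero_mul]
  · rintro rfl
    exact OreLocalization.zero_oreDiv s


/-- Let `S` be a multiplicatively closed set of central non-zero-divisors of `R`. For a
fraction `u⁻¹ * a = a /ₒ u` in the localization `S⁻¹R`, the left (resp. right)
annihilator of `u⁻¹ * a` is a two-sided ideal of `S⁻¹R` if and only if the left (resp.
right) annihilator of `a` is a two-sided ideal of `R`. -/
theorem annihilator_ideal_localization_iff {R : Type*} [Ring R] (S : Submonoid R)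
    (hcentral : ∀ s ∈ S, ∀ r : R, s * r = r * s)
    (hnzd : ∀ s ∈ S, ∀ x : R, (x * s = 0 → x = 0) ∧ (s * x = 0 → x = 0))
    (a : R) (u : S) :
    letI := centralOreSet S hcentral
    ((∃ I : TwoSidedIdeal (OreLocalization S R),
        (I : Set (OreLocalization S R)) = {x | x * (a /ₒ u) = 0}) ↔
      (∃ I : TwoSidedIdeal R, (I : Set R) = {x | x * a = 0})) ∧
    ((∃ I : TwoSidedIdeal (OreLocalization S R),
        (I : Set (OreLocalization S R)) = {x | (a /ₒ u) * x = 0}) ↔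
      (∃ I : TwoSidedIdeal R, (I : Set R) = {x | a * x = 0})) := by
  let := centralOreSet S hcentral
  have hzero := OreLocalization.oreDiv_eq_zero_iff hcentral fun s hs x => (hnzd s hs x).2
  have hmul := OreLocalization.oreDiv_mul_oreDiv_of_central hcentral
  refine ⟨?_, ?_⟩
  · rw [exists_twoSidedIdeal_eq_leftAnnihilator_iff, exists_twoSidedIdeal_eq_leftAnnihilator_iff]
    constructor
    · intro h x y
      simpa only [hmul, hzero] using h (x /ₒ 1) (y /ₒ 1)
    · intro h x y
      induction x with | _ x s
      induction y with | _ y t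
      simpa only [hmul, hzero] using h x y
  · rw [exists_twoSidedIdeal_eq_rightAnnihilator_iff, exists_twoSidedIdeal_eq_rightAnnihilator_iff]
    constructor
    · intro h x y
      simpa only [hmul, hzero] using h (x /ₒ 1) (y /ₒ 1)
    · intro h x y
      induction x with | _ x s
      induction y with | _ y t
      simpa only [hmul, hzero] using h x y
end

section
/- Let R be a ring and S a multiplicatively closed subset of R consisting of central non-zero-divisors. Then R is pointwise semicommutative if and only if the localization S⁻¹R is pointwise semicommutative. -/
section CentralLocalization

variable {R : Type*} [Ring R] (S : Submonoid R) (hcentral : ∀ s ∈ S, ∀ r : R, s * r = r * s)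

/-- Fractions with central denominators multiply componentwise. -/
theorem centralOreSet_oreDiv_mul_oreDiv (a b : R) (s t : S) :
    letI := centralOreSet S hcentral
    (OreLocalization.oreDiv a s * OreLocalization.oreDiv b t : OreLocalization S R) =
      OreLocalization.oreDiv (a * b) (t * s) :=
  letI := centralOreSet S hcentral
  OreLocalization.oreDiv_mul_char a b s t a t (hcentral t t.2 a)

/-- A fraction whose denominator is central and regular vanishes iff its numerator does. -/
theorem centralOreSet_oreDiv_eq_zero_iff (hreg : ∀ s ∈ S, ∀ x : R, s * x = 0 → x = 0)
    (a : R) (s : S) :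
    letI := centralOreSet S hcentral
    (OreLocalization.oreDiv a s : OreLocalization S R) = 0 ↔ a = 0 := by
  let := centralOreSet S hcentral
  refine ⟨fun h => ?_, fun h => h ▸ OreLocalization.zero_oreDiv s⟩
  rw [OreLocalization.zero_def, OreLocalization.oreDiv_eq_iff] at h
  obtain ⟨u, v, hva, hvs⟩ := h
  rw [smul_zero, smul_eq_mul] at hva
  rw [OneMemClass.coe_one, mul_one] at hvs
  refine hreg u u.2 a ?_
  rw [hvs, mul_assoc, hcentral s s.2 a, ← mul_assoc, ← hva, zero_mul]

end CentralLocalization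

/-- Let `S` be a multiplicatively closed set of central non-zero-divisors of `R`. Then
`R` is pointwise semicommutative if and only if the localization `S⁻¹R` is pointwise
semicommutative. -/
theorem pointwiseSemicommutative_localization_iff {R : Type*} [Ring R] (S : Submonoid R)
    (hcentral : ∀ s ∈ S, ∀ r : R, s * r = r * s)
    (hnzd : ∀ s ∈ S, ∀ x : R, (x * s = 0 → x = 0) ∧ (s * x = 0 → x = 0)) :
    letI := centralOreSet S hcentral
    (PointwiseSemicommutative R ↔ PointwiseSemicommutative (OreLocalization S R)) := by
  let := centralOreSet S hcentral
  have zero_iff := centralOreSet_oreDiv_eq_zero_iff S hcentral fun s hs x => (hnzd s hs x).2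
  have mul_div := centralOreSet_oreDiv_mul_oreDiv S hcentral
  constructor
  · intro h a
    induction a with | _ a s
    refine (h a).imp (fun ha x r hx => ?_) (fun ha x r hx => ?_) <;>
    · induction x with | _ x t
      induction r with | _ r u
      rw [mul_div, zero_iff] at hx
      rw [mul_div, mul_div, zero_iff]
      exact ha x r hx
  · intro h a
    refine (h (OreLocalization.oreDiv a 1)).imp (fun ha x r hx => ?_) (fun ha x r hx => ?_) <;>
    · have key := ha (OreLocalization.oreDiv x 1) (OreLocalization.oreDiv r 1)
      rw [mul_div, mul_div, mul_div, zero_iff, zero_iff] at key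
      exact key hx
end

section
/- For a ring R, the polynomial ring R[x] is pointwise semicommutative if and only if the Laurent polynomial ring R[x, x⁻¹] is pointwise semicommutative. -/
namespace LaurentPolynomial

theorem mul_T_mul_mul_T {R : Type*} [Semiring R] (f g : LaurentPolynomial R) (m n : ℤ) :
    f * T m * (g * T n) = f * g * T (m + n) := by
  rw [mul_assoc, ← mul_assoc (T m), T_mul m g, mul_T_assoc, ← mul_assoc]

theorem mul_T_eq_zero_iff {R : Type*} [Semiring R] (f : LaurentPolynomial R) (n : ℤ) :
    f * T n = 0 ↔ f = 0 :=
  (isUnit_T n).mul_left_eq_zero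

end LaurentPolynomial

/-- The polynomial ring `R[x]` is pointwise semicommutative if and only if the Laurent
polynomial ring `R[x, x⁻¹]` is pointwise semicommutative. -/
theorem polynomial_pointwiseSemicommutative_iff_laurent (R : Type*) [Ring R] :
    PointwiseSemicommutative (Polynomial R) ↔
      PointwiseSemicommutative (LaurentPolynomial R) := by
  constructor
  · intro h a
    obtain ⟨n, p, hp⟩ := LaurentPolynomial.exists_T_pow a
    refine (h p).imp (fun H x r hx => ?_) (fun H x r hx => ?_) <;>
    · obtain ⟨k, q, hq⟩ := LaurentPolynomial.exists_T_pow x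
      obtain ⟨l, s, hs⟩ := LaurentPolynomial.exists_T_pow r
      have := H q s
      simpa only [← Polynomial.toLaurent_eq_zero, map_mul, hp, hq, hs,
        LaurentPolynomial.mul_T_mul_mul_T, LaurentPolynomial.mul_T_eq_zero_iff, hx, true_imp_iff] using this
  · intro h a
    refine (h (Polynomial.toLaurent a)).imp (fun H x r hx => ?_) (fun H x r hx => ?_) <;>
    · have := H (Polynomial.toLaurent x) (Polynomial.toLaurent r)
      simpa only [← map_mul, Polynomial.toLaurent_eq_zero, hx, true_imp_iff] using this
end

section
/- Let R be a pointwise semicommutative ring such that every simple singular left R-module is Wnil-injective. Then R is left non-singular, i.e., the left singular ideal Z(_RR) = {a ∈ R : l(a) is an essential left ideal of R} is zero. -/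
/-- A left `R`-module `M` is *Wnil-injective* if for every nonzero nilpotent `w ∈ R` there
is a positive integer `m` with `w ^ m ≠ 0` such that every `R`-homomorphism
`R·w^m → M` extends to `R → M`. -/
def IsWnilInjective (R : Type*) [Ring R] (M : Type*) [AddCommGroup M] [Module R M] : Prop :=
  ∀ w : R, w ≠ 0 → IsNilpotent w → ∃ m : ℕ, 0 < m ∧ w ^ m ≠ 0 ∧
    ∀ f : (Submodule.span R {w ^ m}) →ₗ[R] M, ∃ g : R →ₗ[R] M,
      ∀ x : Submodule.span R {w ^ m}, g (x : R) = f x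

/-- A left `R`-module `M` is *singular* if the left annihilator of every element of `M` is
an essential left ideal of `R` (i.e. it meets every nonzero left ideal nontrivially). -/
def IsSingularModule (R : Type*) [Ring R] (M : Type*) [AddCommGroup M] [Module R M] : Prop :=
  ∀ m : M, ∀ L : Submodule R R, L ≠ ⊥ → ∃ x ∈ L, x ≠ 0 ∧ x • m = 0

/-- If a left ideal `K` is essential, then so is `{x | x * r ∈ K}` for every `r`. -/
theorem exists_ne_zero_mul_mem_of_essential {R : Type*} [Ring R] {K : Submodule R R}
    (hK : ∀ L : Submodule R R, L ≠ ⊥ → ∃ x ∈ L, x ≠ 0 ∧ x ∈ K) (r : R)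
    (L : Submodule R R) (hL : L ≠ ⊥) : ∃ x ∈ L, x ≠ 0 ∧ x * r ∈ K := by
  obtain ⟨y, hyL, hy⟩ := L.exists_mem_ne_zero_of_ne_bot hL
  by_cases hyr : y * r = 0
  · exact ⟨y, hyL, hy, hyr ▸ K.zero_mem⟩
  obtain ⟨z, hz, hz0, hzK⟩ := hK (Submodule.span R {y * r}) (by simpa using hyr)
  obtain ⟨t, rfl⟩ := Submodule.mem_span_singleton.1 hz
  rw [smul_eq_mul, ← mul_assoc] at hz0 hzK
  exact ⟨t * y, L.smul_mem t hyL, left_ne_zero_of_mul hz0, hzK⟩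

/-- The quotient of a ring by an essential left ideal is a singular module. -/
theorem isSingularModule_quotient {R : Type*} [Ring R] {K : Submodule R R}
    (hK : ∀ L : Submodule R R, L ≠ ⊥ → ∃ x ∈ L, x ≠ 0 ∧ x ∈ K) :
    IsSingularModule R (R ⧸ K) := by
  intro m L hL
  obtain ⟨r, rfl⟩ := K.mkQ_surjective m
  obtain ⟨x, hxL, hx, hxr⟩ := exists_ne_zero_mul_mem_of_essential hK r L hL
  refine ⟨x, hxL, hx, ?_⟩
  rw [← map_smul]
  exact (Submodule.Quotient.mk_eq_zero K).2 hxr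

/-- An element `a` of the left singular ideal with `a R a = 0` vanishes when all simple
singular left modules are Wnil-injective. -/
theorem eq_zero_of_mul_mul_self_eq_zero {R : Type u} [Ring R]
    (hw : ∀ (M : Type u) [AddCommGroup M] [Module R M],
      IsSimpleModule R M → IsSingularModule R M → IsWnilInjective R M)
    {a : R} (ha : ∀ L : Submodule R R, L ≠ ⊥ → ∃ x ∈ L, x ≠ 0 ∧ x * a = 0)
    (haa : ∀ r : R, a * r * a = 0) : a = 0 := by
  by_contra ha0
  let A : Ideal R := LinearMap.ker (LinearMap.toSpanSingleton R R a)
  have mem_A (x : R) : x ∈ A ↔ x * a = 0 := by simp [A]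
  have hA : A ≠ ⊤ := by
    rw [Ideal.ne_top_iff_one, mem_A, one_mul]
    exact ha0
  obtain ⟨M, hM, hAM⟩ := Ideal.exists_le_maximal A hA
  have hsing : IsSingularModule R (R ⧸ M) := isSingularModule_quotient fun L hL ↦ by
    obtain ⟨x, hx, hx0, hxa⟩ := ha L hL
    exact ⟨x, hx, hx0, hAM ((mem_A x).2 hxa)⟩
  have hsimple : IsSimpleModule R (R ⧸ M) := isSimpleModule_iff_isCoatom.2 hM.out
  have hsq : a ^ 2 = 0 := by simpa [sq] using haa 1
  obtain ⟨m, hm, hm0, hext⟩ := hw (R ⧸ M) hsimple hsing a ha0 ⟨2, hsq⟩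
  obtain rfl : m = 1 := by
    by_contra hm1
    exact hm0 (pow_eq_zero_of_le (by omega) hsq)
  rw [pow_one] at hext
  have hker (c : R) (hc : c • a = 0) : c • M.mkQ 1 = 0 := by
    rw [← map_smul, smul_eq_mul, mul_one]
    exact (Submodule.Quotient.mk_eq_zero M).2 (hAM ((mem_A c).2 hc))
  obtain ⟨g, hg⟩ := hext (LinearPMap.mkSpanSingleton' a (M.mkQ 1) hker).toFun
  have hga : g a = M.mkQ 1 := by
    have := hg ⟨a, Submodule.mem_span_singleton_self a⟩
    rw [this]
    exact LinearPMap.mkSpanSingleton'_apply_self a _ hker _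
  obtain ⟨c, hc⟩ := M.mkQ_surjective (g 1)
  have hgc : g a = M.mkQ (a * c) := by
    rw [← smul_eq_mul, map_smul, hc, ← map_smul, smul_eq_mul, mul_one]
  have hac : M.mkQ (a * c) = 0 :=
    (Submodule.Quotient.mk_eq_zero M).2 (hAM ((mem_A _).2 (haa c)))
  refine hM.ne_top ((Ideal.eq_top_iff_one M).2 ((Submodule.Quotient.mk_eq_zero M).1 ?_))
  exact hga.symm.trans (hgc.trans hac)

/-- A pointwise semicommutative ring all of whose simple singular left modules are
Wnil-injective is left non-singular: the left singular ideal is zero. -/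
theorem leftNonsingular_of_pointwiseSemicommutative (R : Type u) [Ring R]
    (hR : PointwiseSemicommutative R)
    (hw : ∀ (M : Type u) [AddCommGroup M] [Module R M],
      IsSimpleModule R M → IsSingularModule R M → IsWnilInjective R M) :
    ∀ a : R, (∀ L : Submodule R R, L ≠ ⊥ → ∃ x ∈ L, x ≠ 0 ∧ x * a = 0) → a = 0 := by
  have square_zero {b : R} (hb : ∀ L : Submodule R R, L ≠ ⊥ → ∃ x ∈ L, x ≠ 0 ∧ x * b = 0)
      (hbb : b * b = 0) : b = 0 :=
    eq_zero_of_mul_mul_self_eq_zero hw hb fun r ↦ (hR b).elim (· b r hbb) (· b r hbb)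
  intro a ha
  by_contra ha0
  obtain ⟨z, hz, hz0, hza⟩ := ha (Submodule.span R {a}) (by simpa using ha0)
  obtain ⟨r, rfl⟩ := Submodule.mem_span_singleton.1 hz
  rw [smul_eq_mul] at hz0 hza
  have hara : a * r * a = 0 := by
    refine square_zero (fun L hL ↦ ?_) ?_
    · obtain ⟨x, hx, hx0, hxa⟩ := ha L hL
      exact ⟨x, hx, hx0, by rw [← mul_assoc, ← mul_assoc, hxa, zero_mul, zero_mul]⟩
    · calc a * r * a * (a * r * a) = a * (r * a * a) * (r * a) := by simp only [mul_assoc]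
        _ = 0 := by rw [hza, mul_zero, zero_mul]
  refine hz0 (square_zero (fun L hL ↦ ?_) ?_)
  · obtain ⟨x, hx, hx0, hxr⟩ := exists_ne_zero_mul_mem_of_essential
      (K := LinearMap.ker (LinearMap.toSpanSingleton R R a)) (by simpa using ha) r L hL
    exact ⟨x, hx, hx0, by simpa [mul_assoc] using hxr⟩
  · calc r * a * (r * a) = r * (a * r * a) := by simp only [mul_assoc]
      _ = 0 := by rw [hara, mul_zero]
end

section
/- Let R be a pointwise semicommutative ring such that every simple singular left R-module is Wnil-injective and such that e·r = e·r·e for every idempotent e ∈ R and every r ∈ R. Then R is reduced, i.e., R has no nonzero nilpotent elements. -/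
/-- A left ideal is essential if it meets every nonzero left ideal nontrivially. -/
def IsEssentialLeftIdeal {R : Type*} [Ring R] (I : Submodule R R) : Prop :=
  ∀ L : Submodule R R, L ≠ ⊥ → ∃ x ∈ L, x ≠ 0 ∧ x ∈ I

/-- The quotient of a ring by an essential left ideal is a singular module. -/
theorem IsEssentialLeftIdeal.isSingularModule_quotient {R : Type*} [Ring R]
    {I : Submodule R R} (hI : IsEssentialLeftIdeal I) : IsSingularModule R (R ⧸ I) := by
  intro m L hL
  obtain ⟨y, rfl⟩ := Submodule.Quotient.mk_surjective I m
  obtain ⟨l, hl, hl0⟩ := Submodule.exists_mem_ne_zero_of_ne_bot hL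
  by_cases hly : l * y = 0
  · refine ⟨l, hl, hl0, ?_⟩
    rw [← Submodule.Quotient.mk_smul, smul_eq_mul, hly, Submodule.Quotient.mk_zero]
  · obtain ⟨x, hx, hx0, hxI⟩ := hI (Submodule.span R {l * y})
      (by simpa [Submodule.span_singleton_eq_bot] using hly)
    obtain ⟨r, rfl⟩ := Submodule.mem_span_singleton.1 hx
    refine ⟨r * l, L.smul_mem r hl, fun h => hx0 ?_, ?_⟩
    · rw [smul_eq_mul, ← mul_assoc, h, zero_mul]
    · rw [← Submodule.Quotient.mk_smul, Submodule.Quotient.mk_eq_zero]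
      simpa [mul_assoc] using hxI

/-- A maximal left ideal that is not essential is the left annihilator of an idempotent lying
outside it. -/
theorem exists_idempotent_of_not_isEssentialLeftIdeal {R : Type*} [Ring R]
    {I : Submodule R R} (hI : IsCoatom I) (hess : ¬ IsEssentialLeftIdeal I) :
    ∃ e : R, e * e = e ∧ e ∉ I ∧ ∀ x ∈ I, x * e = 0 := by
  simp only [IsEssentialLeftIdeal] at hess
  push Not at hess
  obtain ⟨L, hL, hLI⟩ := hess
  have hdisj : ∀ x ∈ L, x ∈ I → x = 0 := fun x hx hxI => by
    by_contra hx0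
    exact hLI x hx hx0 hxI
  have hlt : I < I ⊔ L := by
    obtain ⟨l, hl, hl0⟩ := Submodule.exists_mem_ne_zero_of_ne_bot hL
    exact left_lt_sup.2 fun hle => hl0 (hdisj l hl (hle hl))
  have htop : (1 : R) ∈ I ⊔ L := hI.2 _ hlt ▸ Submodule.mem_top
  obtain ⟨m, hm, e, he, hme⟩ := Submodule.mem_sup.1 htop
  have hsub : ∀ x : R, x * e = x - x * m := fun x => by
    rw [eq_sub_iff_add_eq', ← mul_add, hme, mul_one]
  refine ⟨e, ?_, fun heI => hI.1 ?_, fun x hx => ?_⟩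
  · have hem : e * m = e - e * e := by rw [hsub, sub_sub_cancel]
    have h0 : e * m = 0 :=
      hdisj _ (hem ▸ L.sub_mem he (L.smul_mem e he)) (I.smul_mem e hm)
    rw [hsub, h0, sub_zero]
  · exact (Ideal.eq_top_iff_one I).2 (hme ▸ I.add_mem hm heI)
  · exact hdisj _ (L.smul_mem x he) (hsub x ▸ I.sub_mem hx (I.smul_mem x hm))

/-- A pointwise semicommutative ring all of whose simple singular left modules are
Wnil-injective, in which `e * r = e * r * e` for every idempotent `e` and every `r`,
is reduced. -/
theorem reduced_of_pointwiseSemicommutative (R : Type u) [Ring R]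
    (hR : PointwiseSemicommutative R)
    (hw : ∀ (M : Type u) [AddCommGroup M] [Module R M],
      IsSimpleModule R M → IsSingularModule R M → IsWnilInjective R M)
    (habel : ∀ e : R, e * e = e → ∀ r : R, e * r = e * r * e) :
    ∀ a : R, IsNilpotent a → a = 0 := by
  suffices h : ∀ a : R, a ^ 2 = 0 → a = 0 from
    ((isReduced_iff_pow_one_lt 2 one_lt_two).2 h).eq_zero
  intro a ha2
  have ha : a * a = 0 := by rwa [← sq]
  by_contra ha0
  have hann : LinearMap.ker (LinearMap.toSpanSingleton R R a) ≠ ⊤ := fun h => ha0 <| by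
    have h1 : (1 : R) ∈ LinearMap.ker (LinearMap.toSpanSingleton R R a) := h ▸ Submodule.mem_top
    simpa using h1
  obtain ⟨I, hI, hle⟩ := Ideal.exists_le_maximal _ hann
  have hmem : ∀ x : R, x * a = 0 → x ∈ I := fun x hx => hle (by simpa using hx)
  have hess : IsEssentialLeftIdeal I := by
    by_contra hess
    obtain ⟨e, hee, heI, hIe⟩ := exists_idempotent_of_not_isEssentialLeftIdeal hI.out hess
    exact heI (hmem e (by rw [habel e hee a, mul_assoc, hIe a (hmem a ha), mul_zero]))
  obtain ⟨m, hm, ham, hext⟩ := hw (R ⧸ I) (isSimpleModule_iff_isCoatom.2 hI.out)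
    hess.isSingularModule_quotient a ha0 ⟨2, ha2⟩
  obtain rfl : m = 1 := by
    by_contra hm1
    exact ham (pow_eq_zero_of_le (by omega) ha2)
  rw [pow_one] at hext
  have hwd : ∀ c : R, c • a = 0 → c • (Submodule.Quotient.mk 1 : R ⧸ I) = 0 := fun c hc => by
    rw [← Submodule.Quotient.mk_smul, Submodule.Quotient.mk_eq_zero]
    simpa using hmem c hc
  obtain ⟨g, hg⟩ := hext (LinearPMap.mkSpanSingleton' a (Submodule.Quotient.mk 1) hwd).toFun
  have hga : g a = Submodule.Quotient.mk 1 := by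
    refine (hg ⟨a, Submodule.mem_span_singleton_self a⟩).trans ?_
    exact LinearPMap.mkSpanSingleton'_apply_self _ _ _ _
  obtain ⟨c, hc⟩ := Submodule.Quotient.mk_surjective I (g 1)
  have hac : g a = 0 := by
    have : g a = a • g 1 := by rw [← map_smul, smul_eq_mul, mul_one]
    rw [this, ← hc, ← Submodule.Quotient.mk_smul, Submodule.Quotient.mk_eq_zero]
    exact hmem _ (hR.mul_mul_self_eq_zero ha c)
  rw [hac, eq_comm, Submodule.Quotient.mk_eq_zero] at hga
  exact hI.ne_top ((Ideal.eq_top_iff_one I).2 hga)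
end

section
/- Let R be a pointwise semicommutative ring. If R is left SF (every simple left R-module is flat), then R is strongly regular, i.e., for every a ∈ R there exists x ∈ R with a = a²·x. -/
/-- A left module `M` over a (possibly noncommutative) ring `R` is *flat* if it satisfies
the equational criterion for flatness: every `R`-linear relation `∑ rᵢ • mᵢ = 0` in `M`
factors through a relation in `R`. -/
def IsFlatModule (R : Type*) [Ring R] (M : Type*) [AddCommGroup M] [Module R M] : Prop :=
  ∀ (n : ℕ) (r : Fin n → R) (m : Fin n → M), (∑ i, r i • m i) = 0 →
    ∃ (k : ℕ) (a : Fin n → Fin k → R) (m' : Fin k → M),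
      (∀ i, m i = ∑ j, a i j • m' j) ∧ ∀ j, (∑ i, r i * a i j) = 0

/-- If every simple left module is flat and `r(x)` is a left ideal, then `x` is von Neumann
regular. -/
theorem exists_eq_mul_mul_of_rightAnnihilator {R : Type u} [Ring R]
    (hsf : ∀ (M : Type u) [AddCommGroup M] [Module R M],
      IsSimpleModule R M → IsFlatModule R M)
    {x : R} (hx : ∀ y r : R, x * y = 0 → x * r * y = 0) : ∃ t : R, x = x * t * x := by
  let J : Submodule R R :=
    { carrier := {y | x * y = 0}
      add_mem' := fun {a b} ha hb => by
        simp only [Set.mem_ofPred_eq] at ha hb ⊢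
        rw [mul_add, ha, hb, add_zero]
      zero_mem' := mul_zero x
      smul_mem' := fun r y hy => by
        simpa only [Set.mem_ofPred_eq, smul_eq_mul, mul_assoc] using hx y r hy }
  have hJ (y : R) : y ∈ J ↔ x * y = 0 := Iff.rfl
  have htop : Submodule.span R {x} ⊔ J = ⊤ := by
    by_contra hne
    obtain ⟨M, hM, hle⟩ := Ideal.exists_le_maximal _ hne
    have hxM : x ∈ M :=
      hle (Submodule.mem_sup_left (Submodule.mem_span_singleton_self x))
    obtain ⟨k, a, m, hm, ha⟩ := hsf (R ⧸ (M : Submodule R R))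
      (isSimpleModule_iff_isCoatom.2 hM.out) 1 (fun _ => x)
      (fun _ => Submodule.Quotient.mk 1) (by
        simpa [← Submodule.Quotient.mk_smul] using hxM)
    choose l hl using fun j => Submodule.Quotient.mk_surjective (M : Submodule R R) (m j)
    have hmem : 1 - ∑ j, a 0 j * l j ∈ M := by
      rw [← Submodule.Quotient.eq, hm 0, ← Submodule.mkQ_apply _ (∑ j, a 0 j * l j), map_sum]
      exact Finset.sum_congr rfl fun j _ => by
        rw [← hl j, Submodule.mkQ_apply, ← smul_eq_mul, Submodule.Quotient.mk_smul]
    have hsum : ∑ j, a 0 j * l j ∈ M := hle <| Submodule.mem_sup_right <| (hJ _).2 <| by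
      rw [Finset.mul_sum]
      refine Finset.sum_eq_zero fun j _ => ?_
      rw [← mul_assoc, show x * a 0 j = 0 by simpa using ha j, zero_mul]
    exact hM.ne_top ((Ideal.eq_top_iff_one M).2 (by simpa using M.add_mem hmem hsum))
  obtain ⟨z, hz, y, hy, hzy⟩ := Submodule.mem_sup.1 (htop ▸ Submodule.mem_top (x := (1 : R)))
  obtain ⟨t, rfl⟩ := Submodule.mem_span_singleton.1 hz
  refine ⟨t, ?_⟩
  calc x = x * (t • x + y) := by rw [hzy, mul_one]
    _ = x * t * x := by rw [mul_add, (hJ y).1 hy, add_zero, smul_eq_mul, mul_assoc]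

/-- In a pointwise semicommutative left SF ring, an idempotent `e` with `e R (1 - e) = 0` also
satisfies `(1 - e) R e = 0`. -/
theorem one_sub_mul_mul_eq_zero {R : Type u} [Ring R] (hR : PointwiseSemicommutative R)
    (hsf : ∀ (M : Type u) [AddCommGroup M] [Module R M],
      IsSimpleModule R M → IsFlatModule R M)
    {e : R} (he : e * e = e) (h : ∀ r, e * r * (1 - e) = 0) (s : R) :
    (1 - e) * s * e = 0 := by
  have h' (r : R) : e * r = e * r * e := by
    have := h r
    rwa [mul_sub, mul_one, sub_eq_zero] at this
  obtain ⟨c, hc⟩ : ∃ c, c = (1 - e) * s * e := ⟨_, rfl⟩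
  rw [← hc]
  have hce : c * e = c := by rw [hc, mul_assoc, he]
  have hec : e * c = 0 := by
    rw [hc, ← mul_assoc, ← mul_assoc, mul_sub, mul_one, he, sub_self, zero_mul, zero_mul]
  by_contra hc0
  have key : ∀ x y : R, c * x = 0 → c * y * x = 0 := by
    intro x y hcx
    by_contra hne
    have hcex : c * (e * x) = 0 := by rw [← mul_assoc, hce, hcx]
    have hne' : c * y * (e * x) ≠ 0 := by
      have : c * y * (e * x) = c * y * x := by
        calc c * y * (e * x) = c * (e * y * e) * x := by
              simp only [← mul_assoc, hce]
          _ = c * y * x := by rw [← h', ← mul_assoc, hce]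
      rwa [this]
    rcases hR (e * x) with hl | hr
    · exact hne' (hl c y hcex)
    · obtain ⟨t, ht⟩ := exists_eq_mul_mul_of_rightAnnihilator hsf hr
      obtain ⟨q, hq⟩ : ∃ q, q = e * x * t := ⟨_, rfl⟩
      rw [← hq] at ht
      have hqq : q * q = q := by
        nth_rewrite 2 [hq]
        rw [← mul_assoc, ← ht, hq]
      have heq : e * q = q := by rw [hq, ← mul_assoc, ← mul_assoc, he]
      have hcq : c * q = 0 := by rw [hq, ← mul_assoc, hcex, zero_mul]
      have hcyq : c * y * q ≠ 0 := fun h0 => hne' (by rw [ht, ← mul_assoc, h0, zero_mul])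
      rcases hR (e - q) with hl | hr
      · have := hl (1 - e) c (by rw [sub_mul, one_mul, mul_sub, he, heq, sub_self])
        rw [sub_mul, one_mul, hec, sub_zero, mul_sub, hce, hcq, sub_zero] at this
        exact hc0 this
      · have := hr q y (by rw [sub_mul, heq, hqq, sub_self])
        rw [sub_mul, sub_mul, sub_eq_zero] at this
        apply hcyq
        rw [← hce, mul_assoc, mul_assoc, ← mul_assoc e, this, mul_assoc, ← mul_assoc, hcq,
          zero_mul]
  obtain ⟨t, ht⟩ := exists_eq_mul_mul_of_rightAnnihilator hsf key
  apply hc0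
  rw [ht, ← hce, mul_assoc c e t, h' t, mul_assoc, mul_assoc (e * t), hce, hec, mul_zero,
    mul_zero]

/-- A pointwise semicommutative left SF ring is semicommutative. -/
theorem mul_mul_eq_zero_of_leftSF {R : Type u} [Ring R] (hR : PointwiseSemicommutative R)
    (hsf : ∀ (M : Type u) [AddCommGroup M] [Module R M],
      IsSimpleModule R M → IsFlatModule R M)
    (a x y : R) (hax : a * x = 0) : a * y * x = 0 := by
  rcases hR x with hl | hr
  · exact hl a y hax
  obtain ⟨t, ht⟩ := exists_eq_mul_mul_of_rightAnnihilator hsf hr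
  obtain ⟨q, hq⟩ : ∃ q, q = x * t := ⟨_, rfl⟩
  rw [← hq] at ht
  have hqq : q * q = q := by
    nth_rewrite 2 [hq]
    rw [← mul_assoc, ← ht, hq]
  have haq : a * q = 0 := by rw [hq, ← mul_assoc, hax, zero_mul]
  suffices a * y * q = 0 by rw [ht, ← mul_assoc, this, zero_mul]
  rcases hR q with hl | hr
  · exact hl a y haq
  · have := one_sub_mul_mul_eq_zero hR hsf hqq
      (fun r => hr (1 - q) r (by rw [mul_sub, mul_one, hqq, sub_self])) y
    rw [sub_mul, sub_mul, one_mul, sub_eq_zero] at this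
    rw [mul_assoc, this, mul_assoc, ← mul_assoc, haq, zero_mul]

/-- A pointwise semicommutative left SF ring (every simple left module is flat) is
strongly regular. -/
theorem stronglyRegular_of_pointwiseSemicommutative_leftSF (R : Type u) [Ring R]
    (hR : PointwiseSemicommutative R)
    (hsf : ∀ (M : Type u) [AddCommGroup M] [Module R M],
      IsSimpleModule R M → IsFlatModule R M) :
    ∀ a : R, ∃ x : R, a = a ^ 2 * x := by
  intro a
  have hsc := mul_mul_eq_zero_of_leftSF hR hsf
  obtain ⟨t, ht⟩ := exists_eq_mul_mul_of_rightAnnihilator hsf fun x r => hsc a x r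
  have h : a * t * a * (1 - a * t) = 0 :=
    hsc _ _ a (by rw [mul_sub, mul_one, ← mul_assoc, ← ht, sub_self])
  rw [← ht, mul_sub, mul_one, sub_eq_zero] at h
  exact ⟨t, by rw [pow_two, mul_assoc]; exact h⟩
end
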